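/- Let \(\mathsf{D}\) be a finite-dimensional graded division algebra with center \(\mathsf{F}\), with canonical subalgebras \(\mathsf{U},\mathsf{Z},\mathsf{C}\). Let M be a maximal subfield of \(\mathsf{D}_0\), let \(\mathsf{L}=M\otimes_{\mathsf{F}_0}\mathsf{F}\) (the graded subfield of \(\mathsf{D}\) generated over \(\mathsf{F}\) by M), and let \(\mathsf{T}\) be a maximal graded subfield of \(\mathsf{C}\). Then the compositum \(\mathsf{M}=\mathsf{L}\cdot\mathsf{T}\) is a maximal graded subfield of \(\mathsf{D}\). Moreover, if \(M/\mathsf{F}_0\) is Galois (respectively, normal) then \(\mathsf{M}/\mathsf{F}\) is Galois (respectively, normal). -/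

import Mathlib

noncomputable section

namespace GradedDivPaper

variable {Γ : Type*} [AddCommGroup Γ] [DecidableEq Γ]
variable {D : Type*} [Ring D]

/-- The (additive) group `Γ` is torsion-free. -/
def TorsionFree (Γ : Type*) [AddCommGroup Γ] : Prop :=
  ∀ (γ : Γ) (n : ℕ), n ≠ 0 → n • γ = 0 → γ = 0

/-- A `Γ`-graded ring is a graded division ring if `1 ≠ 0` and every nonzero
homogeneous element is a unit. -/
def IsGradedDivisionRing (𝒜 : Γ → AddSubgroup D) [GradedRing 𝒜] : Prop :=
  (0 : D) ≠ 1 ∧ ∀ (γ : Γ), ∀ x ∈ 𝒜 γ, x ≠ 0 → IsUnit x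

/-- A subring `E` of a graded ring is a graded subring if it contains all homogeneous
components of each of its elements. -/
def IsGradedSubring (𝒜 : Γ → AddSubgroup D) [GradedRing 𝒜] (E : Subring D) : Prop :=
  ∀ x ∈ E, ∀ γ : Γ, (DirectSum.decompose 𝒜 x γ : D) ∈ E

/-- A graded subring which is itself a graded division ring (nonzero homogeneous elements
of `E` are invertible in `E`). -/
def IsGradedDivSubring (𝒜 : Γ → AddSubgroup D) [GradedRing 𝒜] (E : Subring D) : Prop :=
  IsGradedSubring 𝒜 E ∧
    ∀ (γ : Γ), ∀ x ∈ E, x ∈ 𝒜 γ → x ≠ 0 → ∃ y ∈ E, x * y = 1 ∧ y * x = 1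

/-- A graded subfield: a commutative graded division subring. -/
def IsGradedSubfield (𝒜 : Γ → AddSubgroup D) [GradedRing 𝒜] (K : Subring D) : Prop :=
  IsGradedDivSubring 𝒜 K ∧ ∀ x ∈ K, ∀ y ∈ K, x * y = y * x

/-- The grade set `Γ_E` of a subring `E`: the degrees in which `E` has nonzero
homogeneous elements. -/
def gradeSet (𝒜 : Γ → AddSubgroup D) (E : Subring D) : Set Γ :=
  {γ : Γ | ∃ x : D, x ∈ E ∧ x ∈ 𝒜 γ ∧ x ≠ 0}

/-- The index `|A : B|` of subsets of `Γ`: the number of classes of `A` modulo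
translation by `B`. -/
def addSetIndex (A B : Set Γ) : ℕ :=
  Nat.card (Quot (fun x y : A => (x : Γ) - (y : Γ) ∈ B))

/-- `[R : S]`: the rank of the ring `R` as a module over a subring `S`. -/
def dimOver {R : Type*} [Ring R] (S : Subring R) : ℕ := Module.finrank S R

/-- `R` has finite rank over the subring `S`. -/
def finiteOver {R : Type*} [Ring R] (S : Subring R) : Prop := Module.Finite S R

/-- `[A : B]`: the rank of a subring `A` of `R` over a subring `B` (i.e. over `B ∩ A`). -/
def relDim {R : Type*} [Ring R] (B A : Subring R) : ℕ :=
  Module.finrank (B.comap A.subtype) A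

/-- The degree-0 component of a graded ring, as a subring. -/
def grade0 (𝒜 : Γ → AddSubgroup D) [GradedRing 𝒜] : Subring D where
  carrier := 𝒜 0
  zero_mem' := (𝒜 0).zero_mem
  add_mem' := fun ha hb => (𝒜 0).add_mem ha hb
  neg_mem' := fun ha => (𝒜 0).neg_mem ha
  one_mem' := SetLike.one_mem_graded 𝒜
  mul_mem' := fun ha hb => by simpa using SetLike.mul_mem_graded ha hb

/-- `L/F` is a Galois extension (inside an ambient ring `R`): `F ≤ L` and `F` is exactly
the fixed ring of the group of ring automorphisms of `L` fixing `F` pointwise. -/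
def IsGaloisExt {R : Type*} [Ring R] (F L : Subring R) : Prop :=
  F ≤ L ∧ ∀ x : L,
    (∀ σ : L ≃+* L, (∀ y : L, (y : R) ∈ F → σ y = y) → σ x = x) → (x : R) ∈ F

/-- `p` is the minimal polynomial of `c` over the subring `F`: the monic polynomial with
coefficients in `F` annihilating `c` of least degree. -/
def IsMinPolyOf {R : Type*} [Ring R] (F : Subring R) (c : R) (p : Polynomial F) : Prop :=
  p.Monic ∧ Polynomial.eval₂ F.subtype c p = 0 ∧
    ∀ q : Polynomial F, q.Monic → Polynomial.eval₂ F.subtype c q = 0 → p.degree ≤ q.degree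

/-- The polynomial `p` over `F` splits into linear factors over `L`. -/
def SplitsIn {R : Type*} [Ring R] {F L : Subring R} (h : F ≤ L) (p : Polynomial F) : Prop :=
  ∃ s : List L,
    p.map (Subring.inclusion h) = (s.map fun a => Polynomial.X - Polynomial.C a).prod

/-- Normality for an extension of graded subfields: the minimal polynomial over `F` of
every homogeneous element of `L` splits over `L`. -/
def IsNormalExtGr (𝒜 : Γ → AddSubgroup D) [GradedRing 𝒜] (F L : Subring D) : Prop :=
  ∃ h : F ≤ L, ∀ c ∈ L, (∃ γ : Γ, c ∈ 𝒜 γ) →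
    ∀ p : Polynomial F, IsMinPolyOf F c p → SplitsIn h p

/-- Normality for an (ungraded) extension of subfields: the minimal polynomial over `F`
of every element of `L` splits over `L`. -/
def IsNormalExt {R : Type*} [Ring R] (F L : Subring R) : Prop :=
  ∃ h : F ≤ L, ∀ c ∈ L, ∀ p : Polynomial F, IsMinPolyOf F c p → SplitsIn h p

/-- `K` is a (commutative) subfield of the subring `A`. -/
def IsSubfieldOf {R : Type*} [Ring R] (A K : Subring R) : Prop :=
  K ≤ A ∧ (∀ x ∈ K, ∀ y ∈ K, x * y = y * x) ∧
    ∀ x ∈ K, x ≠ 0 → ∃ y ∈ K, x * y = 1 ∧ y * x = 1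

/-- `K` is a maximal subfield of the subring `A`. -/
def IsMaxSubfieldOf {R : Type*} [Ring R] (A K : Subring R) : Prop :=
  IsSubfieldOf A K ∧ ∀ K' : Subring R, IsSubfieldOf A K' → K ≤ K' → K' = K

/-- `T` is a maximal graded subfield of the graded subring `A`. -/
def IsMaxGradedSubfieldOf (𝒜 : Γ → AddSubgroup D) [GradedRing 𝒜] (A T : Subring D) : Prop :=
  IsGradedSubfield 𝒜 T ∧ T ≤ A ∧
    ∀ T' : Subring D, IsGradedSubfield 𝒜 T' → T' ≤ A → T ≤ T' → T' = T

/-- The canonical subalgebra `𝖴 = 𝖣₀ ⊗_{𝖥₀} 𝖥`: the subring generated by `𝖣₀` and `𝖥`. -/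
def Uc (𝒜 : Γ → AddSubgroup D) [GradedRing 𝒜] (F : Subring D) : Subring D :=
  grade0 𝒜 ⊔ F

/-- The canonical subalgebra `𝖹 = Z(𝖣₀) ⊗_{𝖥₀} 𝖥`: the subring generated by the center
of `𝖣₀` and `𝖥`. -/
def Zc (𝒜 : Γ → AddSubgroup D) [GradedRing 𝒜] (F : Subring D) : Subring D :=
  (Subring.centralizer (grade0 𝒜 : Set D) ⊓ grade0 𝒜) ⊔ F

/-- The canonical subalgebra `𝖢 = C_𝖣(𝖴)`. -/
def Cc (𝒜 : Γ → AddSubgroup D) [GradedRing 𝒜] (F : Subring D) : Subring D :=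
  Subring.centralizer (Uc 𝒜 F : Set D)

/-- The canonical subalgebra `𝖤 = C_𝖣(𝖹)`. -/
def Ec (𝒜 : Γ → AddSubgroup D) [GradedRing 𝒜] (F : Subring D) : Subring D :=
  Subring.centralizer (Zc 𝒜 F : Set D)

end GradedDivPaper

theorem eq_zero_of_sum_mul_mul_eq_zero {K ι : Type*} [DivisionRing K] [Fintype ι]
    {b : ι → K} (hb : LinearIndependent (Subring.center K) b) (a : ι → K)
    (ha : ∀ y, ∑ i, a i * y * b i = 0) : a = 0 := by
  classical
  induction hn : (Finset.univ.filter fun i => a i ≠ 0).card using Nat.strong_induction_on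
    generalizing a with
  | _ n ih =>
  by_contra hne
  obtain ⟨j, hj⟩ := Function.ne_iff.mp hne
  have hj : a j ≠ 0 := hj
  have hcen : ∀ w i, w * ((a j)⁻¹ * a i) = (a j)⁻¹ * a i * w := by
    intro w
    have h0 : (fun i => w * ((a j)⁻¹ * a i) - (a j)⁻¹ * a i * w) = 0 := by
      refine ih _ ?_ _ ?_ rfl
      · rw [← hn]
        refine Finset.card_lt_card ⟨fun i => ?_, fun h => ?_⟩
        · simp only [Finset.mem_filter_univ]
          contrapose!
          intro h
          simp [h]
        · have := @h j (by simpa using hj)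
          simp [hj] at this
      · intro y
        have h1 := ha y
        have h2 := ha (w * y)
        calc ∑ i, (w * ((a j)⁻¹ * a i) - (a j)⁻¹ * a i * w) * y * b i
            = w * (a j)⁻¹ * (∑ i, a i * y * b i) - (a j)⁻¹ * ∑ i, a i * (w * y) * b i := by
              rw [Finset.mul_sum, Finset.mul_sum, ← Finset.sum_sub_distrib]
              refine Finset.sum_congr rfl fun i _ => ?_
              noncomm_ring
          _ = 0 := by rw [h1, h2]; simp
    intro i
    exact sub_eq_zero.mp (congrFun h0 i)
  have hz : ∀ i, (a j)⁻¹ * a i ∈ Subring.center K := fun i =>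
    Subring.mem_center_iff.mpr fun w => hcen w i
  have := Fintype.linearIndependent_iff.mp hb (fun i => ⟨_, hz i⟩) (by
    have h1 := ha 1
    simp only [mul_one] at h1
    calc ∑ i, ((a j)⁻¹ * a i) * b i = (a j)⁻¹ * ∑ i, a i * b i := by
          rw [Finset.mul_sum]; exact Finset.sum_congr rfl fun i _ => mul_assoc _ _ _
      _ = 0 := by rw [h1, mul_zero]) j
  simp [hj] at this

theorem exists_ne_zero_forall_map_mul_eq {K : Type*} [DivisionRing K]
    [Module.Finite (Subring.center K) K] (φ : K ≃+* K) (hφ : ∀ z ∈ Subring.center K, φ z = z) :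
    ∃ d : K, d ≠ 0 ∧ ∀ y, φ y * d = d * y := by
  classical
  let Z := Subring.center K
  let b := Module.finBasis Z K
  let Φ : (Fin (Module.finrank Z K) → K) →ₗ[Z] (K →ₗ[Z] K) :=
    { toFun := fun a =>
        { toFun := fun y => ∑ i, a i * y * b i
          map_add' := fun x y => by simp [mul_add, add_mul, Finset.sum_add_distrib]
          map_smul' := fun z y => by
            simp only [Subring.smul_def, smul_eq_mul, RingHom.id_apply, Finset.mul_sum]
            refine Finset.sum_congr rfl fun i _ => ?_
            rw [← mul_assoc, ← mul_assoc, ← mul_assoc,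
              (Subring.mem_center_iff.mp z.2 (a i))] }
      map_add' := fun x y => by
        ext w
        simp [add_mul, Finset.sum_add_distrib]
      map_smul' := fun z y => by
        ext w
        simp [Subring.smul_def, Finset.mul_sum, mul_assoc] }
  have hinj : Function.Injective Φ := (injective_iff_map_eq_zero Φ).mpr fun a ha =>
    eq_zero_of_sum_mul_mul_eq_zero b.linearIndependent a fun y => LinearMap.congr_fun ha y
  have hsurj : Function.Surjective Φ :=
    (LinearMap.injective_iff_surjective_of_finrank_eq_finrank (by
      rw [Module.finrank_pi_fintype, Module.finrank_linearMap]; simp [Z])).mp hinj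
  obtain ⟨a, ha⟩ := hsurj
    { toFun := φ
      map_add' := map_add φ
      map_smul' := fun z y => by
        simp only [Subring.smul_def, smul_eq_mul, map_mul, RingHom.id_apply, hφ z z.2] }
  have ha : ∀ y, ∑ i, a i * y * b i = φ y := fun y => LinearMap.congr_fun ha y
  have hcomm : ∀ y, (fun i => φ y * a i - a i * y) = 0 := fun y => by
    refine eq_zero_of_sum_mul_mul_eq_zero b.linearIndependent _ fun w => ?_
    calc ∑ i, (φ y * a i - a i * y) * w * b i
        = φ y * (∑ i, a i * w * b i) - ∑ i, a i * (y * w) * b i := by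
          rw [Finset.mul_sum, ← Finset.sum_sub_distrib]
          refine Finset.sum_congr rfl fun i _ => ?_
          noncomm_ring
      _ = 0 := by rw [ha, ha, map_mul, sub_self]
  have hne : a ≠ 0 := by
    rintro rfl
    simpa using ha 1
  obtain ⟨i, hi⟩ := Function.ne_iff.mp hne
  exact ⟨a i, hi, fun y => sub_eq_zero.mp (congrFun (hcomm y) i)⟩

theorem IsField.exists_field {R : Type*} [r : Ring R] (h : IsField R) :
    ∃ f : Field R, f.toDivisionRing.toRing = r := ⟨h.toField, rfl⟩

theorem finiteDimensional_of_sum {K Z : Type*} [Field K] [Ring Z] [Algebra K Z]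
    (hfin : ∃ s : Finset Z, ∀ x, ∃ a : Z → K, x = ∑ g ∈ s, algebraMap K Z (a g) * g) :
    FiniteDimensional K Z := by
  obtain ⟨s, hs⟩ := hfin
  refine ⟨⟨s, eq_top_iff.mpr fun x _ => ?_⟩⟩
  obtain ⟨a, rfl⟩ := hs x
  refine Submodule.sum_mem _ fun g hg => ?_
  rw [← Algebra.smul_def]
  exact Submodule.smul_mem _ _ (Submodule.subset_span hg)

theorem exists_aut_of_fixed {K : Type*} {Z : Type*} [rK : Ring K] [rZ : Ring Z] (hK : IsField K)
    (hZ : IsField Z) (i : K →+* Z)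
    (hfin : ∃ s : Finset Z, ∀ x, ∃ a : Z → K, x = ∑ g ∈ s, i (a g) * g)
    (H : Subgroup (RingAut Z)) (hHi : ∀ g ∈ H, ∀ k, g (i k) = i k)
    (hfix : ∀ z, (∀ g ∈ H, g z = z) → ∃ k, i k = z) :
    (∀ {N : Type _} [Ring N], IsField N → ∀ (j : Z →+* N) (τ : N →+* N),
      (∀ k, τ (j (i k)) = j (i k)) → ∃ g ∈ H, ∀ z, τ (j z) = j (g z)) ∧
    (∀ c : RingAut Z → Z, (∀ g ∈ H, c g ≠ 0) → (∀ g ∈ H, ∀ h ∈ H, c (g * h) = c g * g (c h)) →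
      ∃ b, b ≠ 0 ∧ ∀ g ∈ H, g b = c g * b) := by
  classical
  obtain ⟨fK, rfl⟩ := hK.exists_field
  obtain ⟨fZ, rfl⟩ := hZ.exists_field
  let : Algebra K Z := i.toAlgebra
  have : FiniteDimensional K Z := finiteDimensional_of_sum hfin
  let toAlg (g : RingAut Z) (hg : g ∈ H) : Gal(Z/K) := AlgEquiv.ofRingEquiv (f := g) (hHi g hg)
  let H' : Subgroup Gal(Z/K) := H.comap (MulSemiringAction.toRingAut Gal(Z/K) Z)
  have hbot : IntermediateField.fixedField H' = ⊥ := by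
    refine eq_bot_iff.mpr fun z hz => ?_
    rw [IntermediateField.mem_bot]
    refine hfix z fun g hg => ?_
    refine hz ⟨toAlg g hg, ?_⟩
    have : MulSemiringAction.toRingAut Gal(Z/K) Z (toAlg g hg) = g := RingEquiv.ext fun _ => rfl
    change _ ∈ H
    rwa [this]
  have htop : H' = ⊤ := by
    rw [← IntermediateField.fixingSubgroup_fixedField H', hbot,
      IntermediateField.fixingSubgroup_bot]
  have hmem : ∀ g : Gal(Z/K), MulSemiringAction.toRingAut Gal(Z/K) Z g ∈ H := fun g => by
    have : g ∈ H' := htop ▸ Subgroup.mem_top g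
    exact this
  have : IsGalois K Z := .of_fixedField_eq_bot K Z (htop ▸ hbot)
  constructor
  · intro N rN hN j τ hτ
    obtain ⟨fN, rfl⟩ := hN.exists_field
    let : Algebra Z N := j.toAlgebra
    let : Algebra K N := (j.comp i).toAlgebra
    have : IsScalarTower K Z N := .of_algebraMap_eq fun _ => rfl
    let f : Z →ₐ[K] N := { τ.comp j with commutes' := hτ }
    refine ⟨_, hmem (Normal.algHomEquivAut K N Z f), fun z => ?_⟩
    exact (DFunLike.congr_fun ((Normal.algHomEquivAut K N Z).symm_apply_apply f) z).symm
  · intro c hc hcoc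
    obtain ⟨b, hb⟩ := groupCohomology.isMulCoboundary₁_of_isMulCocycle₁_of_aut_to_units
      (fun g : Gal(Z/K) => Units.mk0 (c (MulSemiringAction.toRingAut Gal(Z/K) Z g)) (hc _ (hmem g)))
      (fun g h => Units.ext (by
        rw [Units.val_mul, Units.val_mk0, map_mul, hcoc _ (hmem g) _ (hmem h), mul_comm]
        rfl))
    refine ⟨b, b.ne_zero, fun g hg => ?_⟩
    have h1 := congrArg Units.val (div_eq_iff_eq_mul.mp (hb (toAlg g hg)))
    have : MulSemiringAction.toRingAut Gal(Z/K) Z (toAlg g hg) = g := RingEquiv.ext fun _ => rfl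
    rw [Units.val_mul, Units.val_mk0, this] at h1
    exact h1

open Polynomial in
theorem exists_split_over_aut {K N : Type*} [rK : Ring K] [rN : Ring N] (hK : IsField K)
    (hN : IsField N) (i : K →+* N)
    (hfin : ∃ s : Finset N, ∀ x, ∃ a : N → K, x = ∑ g ∈ s, i (a g) * g)
    (hnorm : ∀ (c : N) (p : K[X]), p.Monic → eval₂ i c p = 0 →
      (∀ q : K[X], q.Monic → eval₂ i c q = 0 → p.degree ≤ q.degree) →
      ∃ s : List N, p.map i = (s.map fun a => X - C a).prod) (u : N) :
    ∃ (P : K[X]) (l : List (N ≃+* N)), P.Monic ∧ (∀ τ ∈ l, ∀ k, τ (i k) = i k) ∧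
      eval₂ i u P = 0 ∧ P.map i = (l.map fun τ => X - C (τ u)).prod := by
  obtain ⟨fK, rfl⟩ := hK.exists_field
  obtain ⟨fN, rfl⟩ := hN.exists_field
  let : Algebra K N := i.toAlgebra
  have : FiniteDimensional K N := finiteDimensional_of_sum hfin
  have hsp : ∀ c : N, ∃ s : List N, (minpoly K c).map i = (s.map fun a => X - C a).prod :=
    fun c => hnorm c _ (minpoly.monic (.of_finite K c)) (minpoly.aeval K c)
      fun q hq h => minpoly.min K c hq h
  have : Normal K N := normal_iff.mpr fun c => ⟨.of_finite K c, by
    obtain ⟨s, hs⟩ := hsp c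
    change ((minpoly K c).map i).Splits
    rw [hs]
    refine Splits.listProd fun f hf => ?_
    obtain ⟨a, -, rfl⟩ := List.mem_map.mp hf
    exact Splits.X_sub_C a⟩
  obtain ⟨s, hs⟩ := hsp u
  have hroot : ∀ a ∈ s, ∃ τ : Gal(N/K), τ u = a := fun a ha =>
    minpoly.exists_algEquiv_of_root' (Algebra.IsAlgebraic.isAlgebraic u) (by
      rw [aeval_def, ← eval_map]
      change eval a ((minpoly K u).map i) = 0
      rw [hs, eval_list_prod, List.map_map]
      refine List.prod_eq_zero (List.mem_map.mpr ⟨a, ha, by simp⟩))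
  choose! τ hτ using hroot
  refine ⟨minpoly K u, s.map fun a => (τ a : N ≃+* N), minpoly.monic (.of_finite K u), ?_,
    minpoly.aeval K u, ?_⟩
  · intro σ hσ k
    obtain ⟨a, -, rfl⟩ := List.mem_map.mp hσ
    exact (τ a).commutes k
  · rw [hs, List.map_map]
    congr 1
    refine List.map_congr_left fun a ha => ?_
    simp only [Function.comp]
    rw [← hτ a ha]
    simp [hτ a ha]

theorem exists_primitive_of_finite {Z : Type*} [r : Ring Z] (hZ : IsField Z) (μ : Set Z)
    (hfin : μ.Finite) (h1 : 1 ∈ μ) (hmul : ∀ x ∈ μ, ∀ y ∈ μ, x * y ∈ μ)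
    (hinv : ∀ x ∈ μ, ∃ y ∈ μ, x * y = 1) :
    ∃ (e : ℕ) (ζ : Z), 0 < e ∧ ζ ^ e = 1 ∧ (∀ l, ζ ^ l = 1 → e ∣ l) ∧ ∀ z ∈ μ, z ^ e = 1 := by
  obtain ⟨f, rfl⟩ := hZ.exists_field
  let G : Subgroup Zˣ :=
    { carrier := {u | (u : Z) ∈ μ}
      mul_mem' := fun ha hb => hmul _ ha _ hb
      one_mem' := h1
      inv_mem' := fun {u} hu => by
        obtain ⟨y, hy, h⟩ := hinv _ hu
        have : ((u⁻¹ : Zˣ) : Z) = y := by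
          rw [Units.val_inv_eq_inv_val]
          exact inv_eq_of_mul_eq_one_right h
        change ((u⁻¹ : Zˣ) : Z) ∈ μ
        rwa [this] }
  have : Finite G := by
    have : ((fun u : Zˣ => (u : Z)) ⁻¹' μ).Finite :=
      hfin.preimage Units.val_injective.injOn
    exact this
  obtain ⟨g, hg⟩ := IsCyclic.exists_generator (α := G)
  have key : ∀ l, (((g : Zˣ) : Z) ^ l = 1 ↔ g ^ l = 1) := fun l => by
    rw [Subtype.ext_iff, Units.ext_iff]; simp
  refine ⟨orderOf g, ((g : Zˣ) : Z), orderOf_pos g, (key _).mpr (pow_orderOf_eq_one g),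
    fun l hl => orderOf_dvd_of_pow_eq_one ((key l).mp hl), fun z hz => ?_⟩
  obtain ⟨y, -, hy⟩ := hinv z hz
  have hG : (Units.mkOfMulEqOne z y hy) ∈ G := hz
  have := orderOf_dvd_iff_pow_eq_one.mp (orderOf_dvd_of_mem_zpowers (hg ⟨_, hG⟩))
  simpa [Subtype.ext_iff, Units.ext_iff] using this

section Poly

theorem exists_commRing_of_comm {R : Type*} [r : Ring R] (h : ∀ x y : R, x * y = y * x) :
    ∃ f : CommRing R, f.toRing = r := ⟨{ r with mul_comm := h }, rfl⟩

open Polynomial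

theorem monic_list_prod_of_monic {M ι : Type*} [CommRing M] (l : List ι) (f : ι → M[X])
    (h : ∀ x ∈ l, (f x).Monic) : (l.map f).prod.Monic := by
  simpa using monic_multiset_prod_of_monic (l : Multiset ι) f h

theorem scaleRoots_list_prod_X_sub_C {M ι : Type*} [CommRing M] [Nontrivial M] (l : List ι)
    (u : ι → M) (f : M) : scaleRoots (l.map fun x => X - C (u x)).prod f =
      (l.map fun x => X - C (f * u x)).prod := by
  induction l with
  | nil => simp
  | cons x l ih =>
    have hm : (l.map fun x => X - C (u x)).prod.Monic :=
      monic_list_prod_of_monic _ _ fun x _ => monic_X_sub_C _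
    rw [List.map_cons, List.prod_cons, List.map_cons, List.prod_cons, mul_scaleRoots', ih]
    · congr 1
      ext n
      rcases n with _ | _ | n <;> simp [coeff_X, coeff_C, mul_comm]
    · rw [hm.leadingCoeff, (monic_X_sub_C _).leadingCoeff]; simp

theorem exists_list_of_splitting_pow {K F M ι : Type*} [rK : Ring K] [rF : Ring F] [rM : Ring M]
    (hK : ∀ x y : K, x * y = y * x) (hF : ∀ x y : F, x * y = y * x)
    (hM : ∀ x y : M, x * y = y * x) [Nontrivial M] [NoZeroDivisors M]
    (α : K →+* F) (β : F →+* M) {P : K[X]} (hPm : P.Monic) (f : F) {e : ℕ} (he : 0 < e)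
    {ζ : M} (hζ : ζ ^ e = 1) (hζe : ∀ l, ζ ^ l = 1 → e ∣ l) (l : List ι) (u v : ι → M)
    (hP : P.map (β.comp α) = (l.map fun x => X - C (u x)).prod)
    (hv : ∀ x ∈ l, v x ^ e = β f * u x) (u₀ c : M) (hc : c ^ e = β f * u₀)
    (hu₀ : eval₂ (β.comp α) u₀ P = 0) (p : F[X]) (hp : p.Monic)
    (hdvd : ∀ q : F[X], eval₂ β c q = 0 → p ∣ q) :
    ∃ s : List M, p.map β = (s.map fun a => X - C a).prod := by
  obtain ⟨fK, rfl⟩ := exists_commRing_of_comm hK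
  obtain ⟨fF, rfl⟩ := exists_commRing_of_comm hF
  obtain ⟨fM, rfl⟩ := exists_commRing_of_comm hM
  have : IsDomain M := NoZeroDivisors.to_isDomain M
  have hz : IsPrimitiveRoot ζ e := ⟨hζ, hζe⟩
  have hpq := hdvd (expand F e (scaleRoots (P.map α) f)) (by
    rw [← eval_map, map_expand, expand_eval, eval_map, hc, scaleRoots_eval₂_mul, eval₂_map, hu₀,
      mul_zero])
  have hq : (expand F e (scaleRoots (P.map α) f)).map β =
      (l.map fun x => ∏ i ∈ Finset.range e, (X - C (ζ ^ i * v x))).prod := by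
    rw [map_expand, map_scaleRoots, map_map, hP, scaleRoots_list_prod_X_sub_C, map_list_prod,
      List.map_map]
    · congr 1
      refine List.map_congr_left fun x hx => ?_
      rw [← X_pow_sub_C_eq_prod hz he (hv x hx)]
      simp
    · rw [(hPm.map α).leadingCoeff, map_one]
      exact one_ne_zero
  have hs : ((expand F e (scaleRoots (P.map α) f)).map β).Splits := by
    rw [hq]
    refine Splits.listProd fun g hg => ?_
    obtain ⟨x, -, rfl⟩ := List.mem_map.mp hg
    exact Splits.prod fun i _ => Splits.X_sub_C _
  have h0 : (expand F e (scaleRoots (P.map α) f)).map β ≠ 0 := by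
    rw [hq]
    exact (monic_list_prod_of_monic _ _ fun x _ =>
      monic_prod_of_monic _ _ fun i _ => monic_X_sub_C _).ne_zero
  have hps := hs.of_dvd h0 (Polynomial.map_dvd β hpq)
  refine ⟨(p.map β).roots.toList, ?_⟩
  conv_lhs => rw [hps.eq_prod_roots_of_monic (hp.map β), ← Multiset.coe_toList (p.map β).roots,
    Multiset.map_coe, Multiset.prod_coe]

theorem finite_setOf_eval₂_eq_zero {F M : Type*} [rF : Ring F] [rM : Ring M]
    (hF : ∀ x y : F, x * y = y * x) (hM : ∀ x y : M, x * y = y * x) [Nontrivial M]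
    [NoZeroDivisors M] (β : F →+* M) {p : F[X]} (hp : p.Monic) :
    {x : M | eval₂ β x p = 0}.Finite := by
  obtain ⟨fF, rfl⟩ := exists_commRing_of_comm hF
  obtain ⟨fM, rfl⟩ := exists_commRing_of_comm hM
  have : IsDomain M := NoZeroDivisors.to_isDomain M
  simpa [IsRoot, eval_map] using finite_setOfPred_isRoot (hp.map β).ne_zero

theorem coe_eval₂_inclusion {R : Type*} [Ring R] {F L : Subring R} (h : F ≤ L) (m : L) (p : F[X]) :
    ((eval₂ (Subring.inclusion h) m p : L) : R) = eval₂ F.subtype (m : R) p :=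
  hom_eval₂ p (Subring.inclusion h) L.subtype m

theorem eval₂_center_conj {R : Type*} [Ring R] (p : (Subring.center R)[X]) (x : Rˣ) (c : R) :
    eval₂ (Subring.center R).subtype (x * c * ((x⁻¹ : Rˣ) : R)) p =
      x * eval₂ (Subring.center R).subtype c p * ((x⁻¹ : Rˣ) : R) := by
  have h := hom_eval₂ p (Subring.center R).subtype
    (MulSemiringAction.toRingHom (ConjAct Rˣ) R (ConjAct.toConjAct x)) c
  have h1 : (MulSemiringAction.toRingHom (ConjAct Rˣ) R (ConjAct.toConjAct x)).comp
      (Subring.center R).subtype = (Subring.center R).subtype := RingHom.ext fun z => by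
    change (x : R) * z * ((x⁻¹ : Rˣ) : R) = z
    rw [Subring.mem_center_iff.mp z.2 x, Units.mul_inv_cancel_right]
  rw [h1] at h
  exact h.symm

end Poly

namespace GradedDivPaper

section Graded

variable {Γ : Type*} [AddCommGroup Γ] [DecidableEq Γ] {D : Type*} [Ring D]
variable {𝒜 : Γ → AddSubgroup D} [GradedRing 𝒜]

theorem proj_mem (γ : Γ) (x : D) : GradedRing.proj 𝒜 γ x ∈ 𝒜 γ :=
  (DirectSum.decompose 𝒜 x γ).2

theorem proj_of_mem {γ : Γ} {x : D} (hx : x ∈ 𝒜 γ) : GradedRing.proj 𝒜 γ x = x :=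
  DirectSum.decompose_of_mem_same 𝒜 hx

theorem proj_of_mem_ne {γ δ : Γ} {x : D} (hx : x ∈ 𝒜 γ) (h : γ ≠ δ) :
    GradedRing.proj 𝒜 δ x = 0 :=
  DirectSum.decompose_of_mem_ne 𝒜 hx h

theorem proj_mul_left {γ : Γ} {a : D} (ha : a ∈ 𝒜 γ) (δ : Γ) (x : D) :
    GradedRing.proj 𝒜 (γ + δ) (a * x) = a * GradedRing.proj 𝒜 δ x :=
  DirectSum.coe_decompose_mul_add_of_left_mem 𝒜 ha

theorem proj_mul_right {γ : Γ} {a : D} (ha : a ∈ 𝒜 γ) (δ : Γ) (x : D) :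
    GradedRing.proj 𝒜 (δ + γ) (x * a) = GradedRing.proj 𝒜 δ x * a :=
  DirectSum.coe_decompose_mul_add_of_right_mem 𝒜 ha

open Classical in
theorem proj_mul (γ : Γ) (x y : D) : GradedRing.proj 𝒜 γ (x * y) =
    ∑ ij ∈ (DirectSum.decompose 𝒜 x).support ×ˢ (DirectSum.decompose 𝒜 y).support with
      ij.1 + ij.2 = γ, GradedRing.proj 𝒜 ij.1 x * GradedRing.proj 𝒜 ij.2 y := by
  classical
  simp only [GradedRing.proj_apply, DirectSum.decompose_mul, DirectSum.coe_mul_apply]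

open Classical in
theorem sum_proj (x : D) :
    ∑ γ ∈ (DirectSum.decompose 𝒜 x).support, GradedRing.proj 𝒜 γ x = x :=
  DirectSum.sum_support_decompose 𝒜 x

theorem ext_proj {x y : D} (h : ∀ γ, GradedRing.proj 𝒜 γ x = GradedRing.proj 𝒜 γ y) : x = y :=
  (DirectSum.decompose 𝒜).injective (DFinsupp.ext fun γ => Subtype.ext (h γ))

theorem mem_of_proj_mem {S : Type*} [SetLike S D] [AddSubmonoidClass S D] {s : S} {x : D}
    (h : ∀ γ, GradedRing.proj 𝒜 γ x ∈ s) : x ∈ s := by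
  classical
  rw [← sum_proj (𝒜 := 𝒜) x]
  exact sum_mem fun γ _ => h γ

theorem exists_proj_ne_zero {x : D} (hx : x ≠ 0) : ∃ γ, GradedRing.proj 𝒜 γ x ≠ 0 := by
  by_contra! h
  exact hx (ext_proj (𝒜 := 𝒜) fun γ => by rw [h, map_zero])

theorem isGradedSubring_centralizer {E : Set D}
    (hE : ∀ x ∈ E, ∀ γ : Γ, (DirectSum.decompose 𝒜 x γ : D) ∈ E) :
    IsGradedSubring 𝒜 (Subring.centralizer E) := by
  intro x hx γ
  rw [Subring.mem_centralizer_iff] at hx ⊢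
  intro y hy
  rw [← sum_proj (𝒜 := 𝒜) y, Finset.sum_mul, Finset.mul_sum]
  refine Finset.sum_congr rfl fun δ _ => ?_
  have h := congrArg (GradedRing.proj 𝒜 (δ + γ)) (hx _ (hE y hy δ))
  have hd : ((DirectSum.decompose 𝒜 y δ : 𝒜 δ) : D) ∈ 𝒜 δ := SetLike.coe_mem _
  rw [proj_mul_left hd, add_comm, proj_mul_right hd] at h
  exact h

theorem isGradedSubring_grade0 : IsGradedSubring 𝒜 (grade0 𝒜) := fun x hx γ => by
  by_cases h : 0 = γ
  · subst h
    exact SetLike.coe_mem (DirectSum.decompose 𝒜 x 0)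
  · rw [DirectSum.decompose_of_mem_ne 𝒜 hx h]
    exact zero_mem _

theorem isGradedSubring_inf {A B : Subring D} (hA : IsGradedSubring 𝒜 A)
    (hB : IsGradedSubring 𝒜 B) : IsGradedSubring 𝒜 (A ⊓ B) :=
  fun x hx γ => ⟨hA x hx.1 γ, hB x hx.2 γ⟩

theorem isGradedSubring_center : IsGradedSubring 𝒜 (Subring.center D) := by
  have := isGradedSubring_centralizer (𝒜 := 𝒜) (E := Set.univ) fun _ _ _ => trivial
  rwa [Subring.centralizer_univ] at this

theorem proj_mem_of_graded {E : Subring D} (hE : IsGradedSubring 𝒜 E) {x : D} (hx : x ∈ E)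
    (γ : Γ) : GradedRing.proj 𝒜 γ x ∈ E := hE x hx γ

theorem mem_grade0 {x : D} : x ∈ grade0 𝒜 ↔ x ∈ 𝒜 0 := Iff.rfl

/-- The group of homogeneous units. -/
def homUnits (𝒜 : Γ → AddSubgroup D) [GradedRing 𝒜] : Subgroup Dˣ where
  carrier := {u | ∃ γ, (u : D) ∈ 𝒜 γ ∧ ((u⁻¹ : Dˣ) : D) ∈ 𝒜 (-γ)}
  mul_mem' := by
    rintro u v ⟨γ, hu, hu'⟩ ⟨δ, hv, hv'⟩
    refine ⟨γ + δ, SetLike.mul_mem_graded hu hv, ?_⟩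
    rw [mul_inv_rev, neg_add_rev]
    exact SetLike.mul_mem_graded hv' hu'
  one_mem' := ⟨0, SetLike.one_mem_graded 𝒜, by simpa using SetLike.one_mem_graded 𝒜⟩
  inv_mem' := by
    rintro u ⟨γ, hu, hu'⟩
    exact ⟨-γ, hu', by simpa using hu⟩

theorem exists_homUnit (hD : IsGradedDivisionRing 𝒜) {γ : Γ} {x : D} (hx : x ∈ 𝒜 γ)
    (h0 : x ≠ 0) : ∃ u ∈ homUnits 𝒜, (u : D) = x ∧ ((u⁻¹ : Dˣ) : D) ∈ 𝒜 (-γ) := by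
  obtain ⟨u, rfl⟩ := hD.2 γ x hx h0
  have h : ((u⁻¹ : Dˣ) : D) ∈ 𝒜 (-γ) := by
    have h1 : (u : D) * GradedRing.proj 𝒜 (-γ) ((u⁻¹ : Dˣ) : D) = 1 := by
      rw [← proj_mul_left hx, Units.mul_inv, add_neg_cancel]
      exact proj_of_mem (SetLike.one_mem_graded 𝒜)
    rw [← mul_one ((u⁻¹ : Dˣ) : D), ← h1, Units.inv_mul_cancel_left]
    exact proj_mem _ _
  exact ⟨u, ⟨γ, hx, h⟩, rfl, h⟩

theorem noZeroDivisors (hΓ : TorsionFree Γ) (hD : IsGradedDivisionRing 𝒜) : NoZeroDivisors D := by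
  have : IsAddTorsionFree Γ := ⟨fun n hn x y h => by
    refine sub_eq_zero.mp (hΓ _ n hn ?_)
    rw [nsmul_sub]
    exact sub_eq_zero.mpr h⟩
  have : UniqueSums Γ := UniqueSums.of_injective_addHom
    (DivisibleHull.coeAddMonoidHom (M := Γ)).toAddHom DivisibleHull.coe_injective inferInstance
  refine ⟨fun {x y} hxy => ?_⟩
  by_contra! hne
  obtain ⟨hx, hy⟩ := hne
  classical
  have hs : ∀ z : D, z ≠ 0 → (DirectSum.decompose 𝒜 z).support.Nonempty := fun z hz =>
    (exists_proj_ne_zero (𝒜 := 𝒜) hz).imp fun γ hγ =>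
      DFinsupp.mem_support_iff.mpr fun h => hγ (congrArg Subtype.val h)
  have hx' := hs x hx
  have hy' := hs y hy
  obtain ⟨a, ha, b, hb, hab⟩ := UniqueSums.uniqueAdd_of_nonempty hx' hy'
  have h0 := proj_mul (𝒜 := 𝒜) (a + b) x y
  rw [hxy, map_zero, Finset.sum_eq_single (a, b)] at h0
  · have hxa : GradedRing.proj 𝒜 a x ≠ 0 := fun h =>
      (DFinsupp.mem_support_iff.mp ha) (Subtype.ext h)
    have hyb : GradedRing.proj 𝒜 b y ≠ 0 := fun h =>
      (DFinsupp.mem_support_iff.mp hb) (Subtype.ext h)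
    exact hyb (((hD.2 a _ (proj_mem a x) hxa).mul_right_eq_zero).mp h0.symm)
  · rintro ⟨i, j⟩ hij hne
    simp only [Finset.mem_filter, Finset.mem_product] at hij
    have := hab hij.1.1 hij.1.2 hij.2
    exact absurd (Prod.ext this.1 this.2) hne
  · intro h
    exact (h (Finset.mem_filter.mpr ⟨Finset.mem_product.mpr ⟨ha, hb⟩, rfl⟩)).elim

theorem units_inv_mem_centralizer {S : Set D} {u : Dˣ} (hu : (u : D) ∈ Subring.centralizer S) :
    ((u⁻¹ : Dˣ) : D) ∈ Subring.centralizer S := by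
  rw [Subring.mem_centralizer_iff] at hu ⊢
  intro y hy
  have h : Commute y (u : D) := hu y hy
  exact h.units_inv_right

theorem mem_Cc_center {x : D} :
    x ∈ Cc 𝒜 (Subring.center D) ↔ ∀ y ∈ 𝒜 0, y * x = x * y := by
  have hle : Cc 𝒜 (Subring.center D) ≤ Subring.centralizer (grade0 𝒜 : Set D) :=
    Subring.centralizer_le _ _ (le_sup_left (a := grade0 𝒜))
  refine ⟨fun h => Subring.mem_centralizer_iff.mp (hle h), fun h => ?_⟩
  have h1 : Uc 𝒜 (Subring.center D) ≤ Subring.centralizer {x} := by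
    refine sup_le (fun y hy => ?_) (fun y hy => ?_)
    · rw [Subring.mem_centralizer_iff]
      rintro _ rfl
      exact (h y hy).symm
    · rw [Subring.mem_centralizer_iff]
      rintro _ rfl
      exact Subring.mem_center_iff.mp hy _
  rw [Cc, Subring.mem_centralizer_iff]
  intro y hy
  exact (Subring.mem_centralizer_iff.mp (h1 hy) x rfl).symm

theorem Cc_center_eq :
    Cc 𝒜 (Subring.center D) = Subring.centralizer (grade0 𝒜 : Set D) :=
  Subring.ext fun _ => mem_Cc_center.trans Subring.mem_centralizer_iff.symm

theorem isGradedSubring_Cc : IsGradedSubring 𝒜 (Cc 𝒜 (Subring.center D)) := by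
  rw [Cc_center_eq]
  exact isGradedSubring_centralizer isGradedSubring_grade0

/-- The center of the degree-zero component. -/
def centerGrade0 (𝒜 : Γ → AddSubgroup D) [GradedRing 𝒜] : Subring D :=
  Subring.centralizer (grade0 𝒜 : Set D) ⊓ grade0 𝒜

theorem center_inf_grade0_le : Subring.center D ⊓ grade0 𝒜 ≤ centerGrade0 𝒜 :=
  fun _ hx => ⟨Subring.center_le_centralizer _ hx.1, hx.2⟩

theorem isField_of_inv {K : Subring D} (hD : (0 : D) ≠ 1) (hc : ∀ x ∈ K, ∀ y ∈ K, x * y = y * x)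
    (hi : ∀ x ∈ K, x ≠ 0 → ∃ y ∈ K, x * y = 1) : IsField K where
  exists_pair_ne := ⟨0, 1, fun h => hD (congrArg Subtype.val h)⟩
  mul_comm x y := Subtype.ext (hc x x.2 y y.2)
  mul_inv_cancel {x} hx := by
    obtain ⟨y, hy, h⟩ := hi x x.2 fun h => hx (Subtype.ext h)
    exact ⟨⟨y, hy⟩, Subtype.ext h⟩

theorem isField_center_inf_grade0 (hD : IsGradedDivisionRing 𝒜) :
    IsField ↥(Subring.center D ⊓ grade0 𝒜) := by
  refine isField_of_inv hD.1 (fun x _ y hy => Subring.mem_center_iff.mp hy.1 x) fun x hx h0 => ?_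
  obtain ⟨u, -, rfl, hu⟩ := exists_homUnit hD hx.2 h0
  rw [neg_zero] at hu
  refine ⟨_, ⟨?_, hu⟩, u.mul_inv⟩
  have := units_inv_mem_centralizer (S := Set.univ) (u := u)
  rw [Subring.centralizer_univ] at this
  exact this hx.1

theorem isField_centerGrade0 (hD : IsGradedDivisionRing 𝒜) : IsField ↥(centerGrade0 𝒜) := by
  refine isField_of_inv hD.1 (fun x hx y hy => Subring.mem_centralizer_iff.mp hy.1 x hx.2)
    fun x hx h0 => ?_
  obtain ⟨u, -, rfl, hu⟩ := exists_homUnit hD hx.2 h0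
  rw [neg_zero] at hu
  exact ⟨_, ⟨units_inv_mem_centralizer hx.1, hu⟩, u.mul_inv⟩

theorem exists_span_grade0 (hD : IsGradedDivisionRing 𝒜) (hfin : finiteOver (Subring.center D)) :
    ∃ s : Set D, s.Finite ∧
      ∀ x ∈ 𝒜 0, x ∈ Submodule.span ↥(Subring.center D ⊓ grade0 𝒜) s := by
  classical
  obtain ⟨t, ht⟩ := (show Module.Finite (Subring.center D) D from hfin).fg_top
  have hh : ∀ γ : Γ, ∃ h : D, h ∈ Subring.center D ∧ h ∈ 𝒜 (-γ) ∧
      ∀ f ∈ Subring.center D, f ∈ 𝒜 (-γ) → ∃ a ∈ Subring.center D ⊓ grade0 𝒜, f = a * h := by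
    intro γ
    by_cases hex : ∃ h : D, h ∈ Subring.center D ∧ h ∈ 𝒜 (-γ) ∧ h ≠ 0
    · obtain ⟨h, hc, hm, h0⟩ := hex
      refine ⟨h, hc, hm, fun f hfc hfm => ?_⟩
      obtain ⟨u, -, rfl, hu⟩ := exists_homUnit hD hm h0
      have huc := units_inv_mem_centralizer (S := Set.univ) (u := u)
      rw [Subring.centralizer_univ] at huc
      refine ⟨f * ((u⁻¹ : Dˣ) : D), ⟨mul_mem hfc (huc hc), ?_⟩, by simp⟩
      have := SetLike.mul_mem_graded hfm hu
      rwa [add_neg_cancel] at this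
    · push Not at hex
      exact ⟨0, zero_mem _, zero_mem _, fun f hfc hfm => ⟨0, zero_mem _, by simp [hex f hfc hfm]⟩⟩
  choose h hhc hhm hhf using hh
  refine ⟨⋃ g ∈ t, ⋃ γ ∈ (DirectSum.decompose 𝒜 g).support, {h γ * GradedRing.proj 𝒜 γ g},
    ?_, fun x hx => ?_⟩
  · exact t.finite_toSet.biUnion fun g _ => (Finset.finite_toSet _).biUnion fun _ _ =>
      Set.finite_singleton _
  · have hxt : x ∈ Submodule.span (Subring.center D) (t : Set D) := by rw [ht]; trivial
    obtain ⟨f, -, hf⟩ := Submodule.mem_span_finset.mp hxt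
    rw [← proj_of_mem hx, ← hf, map_sum]
    refine sum_mem fun g hg => ?_
    have h1 : f g • g = ∑ γ ∈ (DirectSum.decompose 𝒜 g).support,
        (f g : D) * GradedRing.proj 𝒜 γ g := by
      rw [← Finset.mul_sum, sum_proj]
      rfl
    rw [h1, map_sum]
    refine sum_mem fun γ hγ => ?_
    have h2 : GradedRing.proj 𝒜 0 ((f g : D) * GradedRing.proj 𝒜 γ g) =
        GradedRing.proj 𝒜 (-γ) (f g : D) * GradedRing.proj 𝒜 γ g := by
      have := proj_mul_right (proj_mem (𝒜 := 𝒜) γ g) (-γ) (f g : D)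
      rwa [neg_add_cancel] at this
    obtain ⟨a, ha, hfa⟩ := hhf γ _ (proj_mem_of_graded isGradedSubring_center (f g).2 (-γ))
      (proj_mem _ _)
    rw [h2, hfa, mul_assoc]
    refine Submodule.smul_mem _ (⟨a, ha⟩ : ↥(Subring.center D ⊓ grade0 𝒜))
      (Submodule.subset_span ?_)
    simp only [Set.mem_iUnion, Set.mem_singleton_iff]
    exact ⟨g, hg, γ, hγ, rfl⟩

theorem exists_finset_sum (hD : IsGradedDivisionRing 𝒜) (hfin : finiteOver (Subring.center D))
    {E : Subring D} (hE : Subring.center D ⊓ grade0 𝒜 ≤ E) (hE0 : E ≤ grade0 𝒜) :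
    ∃ s : Finset E, ∀ x : E, ∃ a : E → ↥(Subring.center D ⊓ grade0 𝒜),
      x = ∑ g ∈ s, Subring.inclusion hE (a g) * g := by
  classical
  obtain ⟨s, hs, hsp⟩ := exists_span_grade0 hD hfin
  have : IsNoetherianRing ↥(Subring.center D ⊓ grade0 𝒜) := by
    obtain ⟨f, hf⟩ := (isField_center_inf_grade0 hD).exists_field
    rw [← hf]
    infer_instance
  have := isNoetherian_span_of_finite ↥(Subring.center D ⊓ grade0 𝒜) hs
  let E' : Submodule ↥(Subring.center D ⊓ grade0 𝒜) D :=
    { carrier := E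
      add_mem' := add_mem
      zero_mem' := zero_mem E
      smul_mem' := fun a x hx => mul_mem (hE a.2) hx }
  obtain ⟨t, ht⟩ := isNoetherian_submodule.mp this E' fun x hx => hsp x (hE0 hx)
  refine ⟨t.subtype (· ∈ E), fun x => ?_⟩
  have hx : (x : D) ∈ Submodule.span ↥(Subring.center D ⊓ grade0 𝒜) (t : Set D) := by
    rw [ht]
    exact x.2
  obtain ⟨f, -, hf⟩ := Submodule.mem_span_finset.mp hx
  have htE : ∀ g ∈ t, g ∈ E := fun g hg => by
    have : g ∈ E' := by rw [← ht]; exact Submodule.subset_span hg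
    exact this
  refine ⟨fun g => f g, Subtype.ext ?_⟩
  rw [AddSubmonoidClass.coe_finsetSum, ← hf]
  exact (Finset.sum_subtype_of_mem (fun g => f g • g) htE).symm

theorem comm_of_mem_bicentralizer {S : Set D} (hS : ∀ a ∈ S, ∀ b ∈ S, a * b = b * a) {a b : D}
    (ha : a ∈ Subring.centralizer (Subring.centralizer S : Set D))
    (hb : b ∈ Subring.centralizer (Subring.centralizer S : Set D)) : a * b = b * a := by
  refine Subring.mem_centralizer_iff.mp hb a ?_
  exact Subring.centralizer_le S _ (fun s hs => Subring.mem_centralizer_iff.mpr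
    fun t ht => hS t ht s hs) ha

theorem subset_bicentralizer {S : Set D} :
    S ⊆ Subring.centralizer (Subring.centralizer S : Set D) :=
  fun _ hs => Subring.mem_centralizer_iff.mpr
    fun _ ht => (Subring.mem_centralizer_iff.mp ht _ hs).symm

theorem comm_insert {K : Subring D} (hK : ∀ x ∈ K, ∀ y ∈ K, x * y = y * x) {x : D}
    (hx : ∀ y ∈ K, y * x = x * y) :
    ∀ a ∈ insert x (K : Set D), ∀ b ∈ insert x (K : Set D), a * b = b * a := by
  rintro a (rfl | ha) b (rfl | hb)
  · rfl
  · exact (hx b hb).symm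
  · exact hx a ha
  · exact hK a ha b hb

theorem inv_mem_of_mem_centralizer (hD : IsGradedDivisionRing 𝒜) {S : Set D} {γ : Γ} {x : D}
    (hx : x ∈ Subring.centralizer S) (hγ : x ∈ 𝒜 γ) (h0 : x ≠ 0) :
    ∃ y ∈ Subring.centralizer S, y ∈ 𝒜 (-γ) ∧ x * y = 1 ∧ y * x = 1 := by
  obtain ⟨u, -, rfl, hu⟩ := exists_homUnit hD hγ h0
  exact ⟨_, units_inv_mem_centralizer hx, hu, u.mul_inv, u.inv_mul⟩

/-- A maximal subfield of the degree-zero component contains its centralizer there. -/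
theorem mem_of_commute_maxSubfield (hD : IsGradedDivisionRing 𝒜) {N : Subring D}
    (hN : IsMaxSubfieldOf (grade0 𝒜) N) {x : D} (hx : x ∈ 𝒜 0) (hc : ∀ y ∈ N, y * x = x * y) :
    x ∈ N := by
  have hS := comm_insert hN.1.2.1 hc
  have h := hN.2 (Subring.centralizer
    (Subring.centralizer (insert x (N : Set D)) : Set D) ⊓ grade0 𝒜)
    ⟨inf_le_right, fun a ha b hb => comm_of_mem_bicentralizer hS ha.1 hb.1, fun a ha h0 => by
      obtain ⟨y, hy, hy0, h1, h2⟩ := inv_mem_of_mem_centralizer hD ha.1 ha.2 h0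
      exact ⟨y, ⟨hy, by rwa [neg_zero] at hy0⟩, h1, h2⟩⟩
    (fun a ha => ⟨subset_bicentralizer (Set.mem_insert_of_mem x ha), hN.1.1 ha⟩)
  rw [← h]
  exact ⟨subset_bicentralizer (Set.mem_insert x _), hx⟩

/-- A maximal graded subfield of the centralizer `𝖢` of the degree-zero component contains the
homogeneous elements of its centralizer in `𝖢`. -/
theorem mem_of_commute_maxGradedSubfield (hD : IsGradedDivisionRing 𝒜) {T : Subring D}
    (hT : IsMaxGradedSubfieldOf 𝒜 (Cc 𝒜 (Subring.center D)) T) {γ : Γ} {x : D} (hx : x ∈ 𝒜 γ)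
    (hxC : x ∈ Cc 𝒜 (Subring.center D)) (hc : ∀ y ∈ T, y * x = x * y) : x ∈ T := by
  have hS := comm_insert hT.1.2 hc
  have hgr : ∀ y ∈ insert x (T : Set D), ∀ γ : Γ,
      (DirectSum.decompose 𝒜 y γ : D) ∈ insert x (T : Set D) := by
    rintro y (rfl | hy) δ
    · by_cases h : γ = δ
      · subst h
        exact Or.inl (proj_of_mem hx)
      · refine Or.inr ?_
        rw [DirectSum.decompose_of_mem_ne 𝒜 hx h]
        exact zero_mem T
    · exact Or.inr (hT.1.1.1 y hy δ)
  have hgr2 := isGradedSubring_centralizer (isGradedSubring_centralizer hgr)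
  have h := hT.2.2 (Subring.centralizer
    (Subring.centralizer (insert x (T : Set D)) : Set D) ⊓ Cc 𝒜 (Subring.center D))
    ⟨⟨isGradedSubring_inf hgr2 isGradedSubring_Cc, fun δ a ha hδ h0 => by
      obtain ⟨u, -, rfl, -⟩ := exists_homUnit hD hδ h0
      exact ⟨_, ⟨units_inv_mem_centralizer ha.1, units_inv_mem_centralizer ha.2⟩,
        u.mul_inv, u.inv_mul⟩⟩,
      fun a ha b hb => comm_of_mem_bicentralizer hS ha.1 hb.1⟩ inf_le_right
    (fun a ha => ⟨subset_bicentralizer (Set.mem_insert_of_mem x ha), hT.2.1 ha⟩)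
  rw [← h]
  exact ⟨subset_bicentralizer (Set.mem_insert x _), hxC⟩

theorem conj_mem {u : Dˣ} (hu : u ∈ homUnits 𝒜) {γ : Γ} {x : D} (hx : x ∈ 𝒜 γ) :
    (u : D) * x * ((u⁻¹ : Dˣ) : D) ∈ 𝒜 γ := by
  obtain ⟨δ, h1, h2⟩ := hu
  have := SetLike.mul_mem_graded (SetLike.mul_mem_graded h1 hx) h2
  rwa [add_neg_cancel_comm] at this

theorem inv_conj_conj (u : Dˣ) (x : D) :
    ((u⁻¹ : Dˣ) : D) * ((u : D) * x * ((u⁻¹ : Dˣ) : D)) * (((u⁻¹)⁻¹ : Dˣ) : D) = x := by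
  simp [mul_assoc]

theorem proj_conj {u : Dˣ} (hu : u ∈ homUnits 𝒜) (γ : Γ) (x : D) :
    GradedRing.proj 𝒜 γ ((u : D) * x * ((u⁻¹ : Dˣ) : D)) =
      u * GradedRing.proj 𝒜 γ x * ((u⁻¹ : Dˣ) : D) := by
  obtain ⟨δ, h1, h2⟩ := hu
  have h := proj_mul_right h2 (δ + γ) ((u : D) * x)
  rwa [proj_mul_left h1, add_neg_cancel_comm] at h

/-- Conjugation by a unit, on a subring stable under it. -/
def conjEquiv (u : Dˣ) (E : Subring D)
    (h : ∀ x ∈ E, (u : D) * x * ((u⁻¹ : Dˣ) : D) ∈ E)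
    (h' : ∀ x ∈ E, ((u⁻¹ : Dˣ) : D) * x * (((u⁻¹)⁻¹ : Dˣ) : D) ∈ E) : E ≃+* E where
  toFun x := ⟨u * x * ((u⁻¹ : Dˣ) : D), h x x.2⟩
  invFun x := ⟨((u⁻¹ : Dˣ) : D) * x * (((u⁻¹)⁻¹ : Dˣ) : D), h' x x.2⟩
  left_inv x := Subtype.ext (inv_conj_conj u x)
  right_inv x := Subtype.ext (by simp [mul_assoc])
  map_mul' x y := Subtype.ext (by simp [mul_assoc])
  map_add' x y := Subtype.ext (by simp [mul_add, add_mul])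

theorem conj_mem_Cc {u : Dˣ} (hu : u ∈ homUnits 𝒜) {x : D}
    (hx : x ∈ Cc 𝒜 (Subring.center D)) :
    (u : D) * x * ((u⁻¹ : Dˣ) : D) ∈ Cc 𝒜 (Subring.center D) := by
  rw [mem_Cc_center] at hx ⊢
  intro y hy
  have h := hx _ (conj_mem (inv_mem hu) hy)
  rw [inv_inv] at h
  calc y * (u * x * ((u⁻¹ : Dˣ) : D))
      = u * ((((u⁻¹ : Dˣ) : D) * y * u) * x) * ((u⁻¹ : Dˣ) : D) := by simp [mul_assoc]
    _ = u * x * ((u⁻¹ : Dˣ) : D) * y := by rw [h]; simp [mul_assoc]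

theorem conj_mem_centerGrade0 {u : Dˣ} (hu : u ∈ homUnits 𝒜) {x : D}
    (hx : x ∈ centerGrade0 𝒜) : (u : D) * x * ((u⁻¹ : Dˣ) : D) ∈ centerGrade0 𝒜 := by
  have h := conj_mem_Cc hu (x := x) (by rw [Cc_center_eq]; exact hx.1)
  rw [Cc_center_eq] at h
  exact ⟨h, conj_mem hu hx.2⟩

/-- A homogeneous unit centralizing `Z(D₀)` is a product of a unit of `D₀` and a homogeneous unit
centralizing `D₀`. -/
theorem exists_mul_of_commute_centerGrade0 (hD : IsGradedDivisionRing 𝒜)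
    (hfin : finiteOver (Subring.center D)) {u : Dˣ} (hu : u ∈ homUnits 𝒜)
    (hc : ∀ z ∈ centerGrade0 𝒜, (u : D) * z = z * u) :
    ∃ d ∈ homUnits 𝒜, (d : D) ∈ 𝒜 0 ∧ ∃ c ∈ homUnits 𝒜,
      (c : D) ∈ Cc 𝒜 (Subring.center D) ∧ u = d * c := by
  have hnt : Nontrivial ↥(grade0 𝒜) := ⟨0, 1, fun h => hD.1 (congrArg Subtype.val h)⟩
  let _ : DivisionRing ↥(grade0 𝒜) := DivisionRing.ofIsUnitOrEqZero fun x => by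
    by_cases h0 : x = 0
    · exact Or.inr h0
    · obtain ⟨v, -, hv, hv'⟩ := exists_homUnit hD x.2 fun h => h0 (Subtype.ext h)
      rw [neg_zero] at hv'
      exact Or.inl ⟨⟨x, ⟨_, hv'⟩, Subtype.ext (by rw [Subring.coe_mul, ← hv]; simp),
        Subtype.ext (by rw [Subring.coe_mul, ← hv]; simp)⟩, rfl⟩
  have hmem : ∀ z : ↥(grade0 𝒜), z ∈ Subring.center ↥(grade0 𝒜) ↔ (z : D) ∈ centerGrade0 𝒜 := by
    intro z
    refine ⟨fun h => ⟨Subring.mem_centralizer_iff.mpr fun y hy =>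
      congrArg Subtype.val (Subring.mem_center_iff.mp h ⟨y, hy⟩), z.2⟩, fun h => ?_⟩
    exact Subring.mem_center_iff.mpr fun y => Subtype.ext (Subring.mem_centralizer_iff.mp h.1 y y.2)
  have : Module.Finite (Subring.center ↥(grade0 𝒜)) ↥(grade0 𝒜) := by
    obtain ⟨s, hs⟩ := exists_finset_sum hD hfin (inf_le_right (a := Subring.center D)) le_rfl
    refine ⟨⟨s, eq_top_iff.mpr fun x _ => ?_⟩⟩
    obtain ⟨a, ha⟩ := hs x
    rw [ha]
    refine sum_mem fun g hg => ?_
    exact Submodule.smul_mem _ (⟨Subring.inclusion inf_le_right (a g),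
      (hmem _).mpr (center_inf_grade0_le (a g).2)⟩ : Subring.center ↥(grade0 𝒜))
      (Submodule.subset_span hg)
  obtain ⟨d, hd0, hd⟩ := exists_ne_zero_forall_map_mul_eq
    (conjEquiv u (grade0 𝒜) (fun x hx => conj_mem hu hx) fun x hx => conj_mem (inv_mem hu) hx)
    fun z hz => Subtype.ext (by
      change (u : D) * z * ((u⁻¹ : Dˣ) : D) = z
      rw [hc z ((hmem z).mp hz), Units.mul_inv_cancel_right])
  obtain ⟨v, hv, hvd, -⟩ := exists_homUnit hD d.2 fun h => hd0 (Subtype.ext h)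
  refine ⟨v, hv, by rw [hvd]; exact d.2, v⁻¹ * u, mul_mem (inv_mem hv) hu, ?_, by simp⟩
  rw [mem_Cc_center]
  intro y hy
  have h : (u : D) * y * ((u⁻¹ : Dˣ) : D) * d = d * y := congrArg Subtype.val (hd ⟨y, hy⟩)
  rw [← hvd] at h
  have h2 : y * ((v⁻¹ * u : Dˣ)⁻¹ : Dˣ) = ((v⁻¹ * u : Dˣ)⁻¹ : Dˣ) * y := by
    have := congrArg (fun w => ((u⁻¹ : Dˣ) : D) * w) h
    simpa [mul_assoc] using this
  have h3 : Commute y (((v⁻¹ * u : Dˣ)⁻¹ : Dˣ) : D) := h2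
  simpa using h3.units_inv_right.eq

/-- Conjugation by homogeneous units moves homogeneous elements of `𝖢` by factors in `Z(D₀)`. -/
theorem exists_conj_eq (hD : IsGradedDivisionRing 𝒜) {u : Dˣ} (hu : u ∈ homUnits 𝒜) {γ : Γ}
    {t : D} (ht : t ∈ 𝒜 γ) (htC : t ∈ Cc 𝒜 (Subring.center D)) :
    ∃ z ∈ centerGrade0 𝒜, z ≠ 0 ∧ (u : D) * t * ((u⁻¹ : Dˣ) : D) = z * t := by
  by_cases h0 : t = 0
  · subst h0
    exact ⟨1, one_mem _, hD.1.symm, by simp⟩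
  obtain ⟨v, hv, rfl, hv'⟩ := exists_homUnit hD ht h0
  refine ⟨u * v * ((u⁻¹ : Dˣ) : D) * ((v⁻¹ : Dˣ) : D), ⟨?_, ?_⟩, ?_, by simp⟩
  · rw [← Cc_center_eq]
    exact mul_mem (conj_mem_Cc hu htC) (units_inv_mem_centralizer htC)
  · have := SetLike.mul_mem_graded (conj_mem hu ht) hv'
    rwa [add_neg_cancel] at this
  · intro h
    have h2 : ((u * v * u⁻¹ * v⁻¹ : Dˣ) : D) = 0 := by simpa using h
    have := congrArg (fun w => w * (((u * v * u⁻¹ * v⁻¹)⁻¹ : Dˣ) : D)) h2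
    simp only [Units.mul_inv, zero_mul] at this
    exact hD.1 this.symm

theorem mem_center_of_homogeneous {x : D} (h : ∀ γ, ∀ y ∈ 𝒜 γ, y * x = x * y) :
    x ∈ Subring.center D := by
  classical
  rw [Subring.mem_center_iff]
  intro y
  rw [← sum_proj (𝒜 := 𝒜) y, Finset.sum_mul, Finset.mul_sum]
  exact Finset.sum_congr rfl fun γ _ => h γ _ (proj_mem γ y)

theorem mem_center_of_homUnits (hD : IsGradedDivisionRing 𝒜) {x : D}
    (h : ∀ u ∈ homUnits 𝒜, (u : D) * x * ((u⁻¹ : Dˣ) : D) = x) : x ∈ Subring.center D := by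
  refine mem_center_of_homogeneous (𝒜 := 𝒜) fun γ y hy => ?_
  by_cases h0 : y = 0
  · simp [h0]
  · obtain ⟨u, hu, rfl, -⟩ := exists_homUnit hD hy h0
    exact (Units.mul_inv_eq_iff_eq_mul _).mp (h u hu)

/-- The automorphisms of `Z(D₀)` induced by homogeneous units. -/
def conjAuts (𝒜 : Γ → AddSubgroup D) [GradedRing 𝒜] : Subgroup (RingAut ↥(centerGrade0 𝒜)) where
  carrier := {g | ∃ u ∈ homUnits 𝒜, ∀ z, (g z : D) = u * z * ((u⁻¹ : Dˣ) : D)}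
  mul_mem' := by
    rintro g h ⟨u, hu, hg⟩ ⟨v, hv, hh⟩
    refine ⟨u * v, mul_mem hu hv, fun z => ?_⟩
    rw [RingAut.mul_apply, hg, hh]
    simp [mul_assoc]
  one_mem' := ⟨1, one_mem _, fun z => by simp⟩
  inv_mem' := by
    rintro g ⟨u, hu, hg⟩
    refine ⟨u⁻¹, inv_mem hu, fun z => ?_⟩
    have h : g (g⁻¹ z) = z := RingEquiv.apply_symm_apply g z
    have h2 := hg (g⁻¹ z)
    rw [h] at h2
    rw [h2, inv_conj_conj]

theorem exists_mem_conjAuts {u : Dˣ} (hu : u ∈ homUnits 𝒜) :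
    ∃ g ∈ conjAuts 𝒜, ∀ z, (g z : D) = u * z * ((u⁻¹ : Dˣ) : D) :=
  ⟨conjEquiv u _ (fun _ => conj_mem_centerGrade0 hu) fun _ => conj_mem_centerGrade0 (inv_mem hu),
    ⟨u, hu, fun _ => rfl⟩, fun _ => rfl⟩

theorem conjAuts_fixes {g : RingAut ↥(centerGrade0 𝒜)} (hg : g ∈ conjAuts 𝒜)
    (k : ↥(Subring.center D ⊓ grade0 𝒜)) :
    g (Subring.inclusion center_inf_grade0_le k) = Subring.inclusion center_inf_grade0_le k := by
  obtain ⟨u, hu, hg⟩ := hg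
  refine Subtype.ext ?_
  rw [hg, Subring.coe_inclusion, Subring.mem_center_iff.mp k.2.1 u, Units.mul_inv_cancel_right]

theorem conjAuts_fixed (hD : IsGradedDivisionRing 𝒜) (z : ↥(centerGrade0 𝒜))
    (hz : ∀ g ∈ conjAuts 𝒜, g z = z) :
    ∃ k, Subring.inclusion (center_inf_grade0_le (𝒜 := 𝒜)) k = z := by
  refine ⟨⟨z, mem_center_of_homUnits hD fun u hu => ?_, z.2.2⟩, rfl⟩
  obtain ⟨g, hg, h⟩ := exists_mem_conjAuts hu
  rw [← h, hz g hg]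

/-- A homogeneous element of the center of `𝖢` is central up to a factor in `Z(D₀)`. -/
theorem exists_mul_mem_center (hD : IsGradedDivisionRing 𝒜)
    (hfin : finiteOver (Subring.center D)) {γ : Γ} {t : D} (ht : t ∈ 𝒜 γ) (h0 : t ≠ 0)
    (htC : t ∈ Cc 𝒜 (Subring.center D))
    (hc : ∀ c ∈ homUnits 𝒜, (c : D) ∈ Cc 𝒜 (Subring.center D) → (c : D) * t = t * c) :
    ∃ z ∈ centerGrade0 𝒜, z ≠ 0 ∧ z * t ∈ Subring.center D := by
  classical
  have hZ := isField_centerGrade0 hD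
  have hch : ∀ g : RingAut ↥(centerGrade0 𝒜), ∃ c : ↥(centerGrade0 𝒜), c ≠ 0 ∧ ∀ u ∈ homUnits 𝒜,
      (∀ z, (g z : D) = u * z * ((u⁻¹ : Dˣ) : D)) →
      (u : D) * t * ((u⁻¹ : Dˣ) : D) = c * t := by
    intro g
    by_cases hg : ∃ u ∈ homUnits 𝒜, ∀ z, (g z : D) = u * z * ((u⁻¹ : Dˣ) : D)
    · obtain ⟨v, hv, hgv⟩ := hg
      obtain ⟨c, hcZ, hc0, hcv⟩ := exists_conj_eq hD hv ht htC
      refine ⟨⟨c, hcZ⟩, fun h => hc0 (congrArg Subtype.val h), fun u hu hgu => ?_⟩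
      obtain ⟨d, -, hd0, e, he, heC, hde⟩ := exists_mul_of_commute_centerGrade0 hD hfin
        (u := v⁻¹ * u) (mul_mem (inv_mem hv) hu) fun z hz => by
          have h := (hgu ⟨z, hz⟩).symm.trans (hgv ⟨z, hz⟩)
          have h2 := congrArg (fun w => ((v⁻¹ : Dˣ) : D) * w * u) h
          simpa [mul_assoc] using h2
      have hu' : u = v * (d * e) := by rw [← hde]; simp
      have h1 : ((d * e : Dˣ) : D) * t = t * (d * e : Dˣ) := by
        rw [Units.val_mul, mul_assoc, hc e he heC, ← mul_assoc,
          mem_Cc_center.mp htC d hd0, mul_assoc]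
      change (u : D) * t * ((u⁻¹ : Dˣ) : D) = c * t
      generalize d * e = w at hu' h1
      rw [← hcv, hu', Units.val_mul, mul_assoc (v : D), h1]
      simp [mul_assoc]
    · exact ⟨1, fun h => hD.1 (congrArg Subtype.val h).symm, fun u hu h => (hg ⟨u, hu, h⟩).elim⟩
  choose c hc0 hcu using hch
  obtain ⟨t, ht', rfl, -⟩ := exists_homUnit hD ht h0
  obtain ⟨b, hb0, hb⟩ := (exists_aut_of_fixed.{_, _, 0} (isField_center_inf_grade0 hD) hZ
    (Subring.inclusion center_inf_grade0_le)
    (exists_finset_sum hD hfin center_inf_grade0_le inf_le_right) (conjAuts 𝒜)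
    (fun g hg k => conjAuts_fixes hg k) (conjAuts_fixed hD)).2 c (fun g _ => hc0 g) (by
      rintro g ⟨u, hu, hgu⟩ h ⟨v, hv, hhv⟩
      have h1 := hcu (g * h) (u * v) (mul_mem hu hv) fun z => by
        rw [RingAut.mul_apply, hgu, hhv]
        simp [mul_assoc]
      have h2 : ((u * v : Dˣ) : D) * t * (((u * v)⁻¹ : Dˣ) : D) =
          u * (v * t * ((v⁻¹ : Dˣ) : D)) * ((u⁻¹ : Dˣ) : D) := by simp [mul_assoc]
      have h3 : (u : D) * (c h * t) * ((u⁻¹ : Dˣ) : D) = g (c h) * (c g * t) := by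
        rw [← hcu g u hu hgu, hgu]
        simp [mul_assoc]
      rw [h2, hcu h v hv hhv, h3, ← mul_assoc, Units.mul_left_inj] at h1
      rw [hZ.mul_comm (c g)]
      exact Subtype.ext h1.symm)
  obtain ⟨b', hb'⟩ := hZ.mul_inv_cancel hb0
  refine ⟨b', b'.2, fun h => ?_, mem_center_of_homUnits hD fun u hu => ?_⟩
  · have := congrArg Subtype.val hb'
    rw [Subring.coe_mul, h, mul_zero] at this
    exact hD.1 this
  · obtain ⟨g, hg, hgu⟩ := exists_mem_conjAuts hu
    have h1 : g b' * c g = b' := by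
      have h := congrArg g hb'
      rw [map_mul, hb g hg, map_one] at h
      calc g b' * c g = (b * b') * (g b' * c g) := by rw [hb', one_mul]
        _ = b' * (c g * b * g b') := by
          rw [hZ.mul_comm b b', mul_assoc, hZ.mul_comm (g b'), ← mul_assoc b,
            hZ.mul_comm b (c g)]
        _ = b' := by rw [h, mul_one]
    calc (u : D) * (b' * t) * ((u⁻¹ : Dˣ) : D)
        = g b' * (u * t * ((u⁻¹ : Dˣ) : D)) := by rw [hgu]; simp [mul_assoc]
      _ = ((g b' * c g : ↥(centerGrade0 𝒜)) : D) * t := by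
          rw [hcu g u hu hgu, Subring.coe_mul, mul_assoc]
      _ = b' * t := by rw [h1]

open Polynomial

/-- A nonzero polynomial over the center annihilating a homogeneous element can be replaced by a
monic one of no larger degree. -/
theorem exists_monic_of_eval₂_center_eq_zero (hD : IsGradedDivisionRing 𝒜) {γ : Γ} {c : D}
    (hc : c ∈ 𝒜 γ) {r : (Subring.center D)[X]} (h0 : r ≠ 0)
    (hr : eval₂ (Subring.center D).subtype c r = 0) :
    ∃ q : (Subring.center D)[X], q.Monic ∧ eval₂ (Subring.center D).subtype c q = 0 ∧
      q.natDegree ≤ r.natDegree := by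
  set d := r.natDegree with hd
  obtain ⟨δ, hδ⟩ := exists_proj_ne_zero (𝒜 := 𝒜) (x := (r.coeff d : D)) fun h =>
    h0 (leadingCoeff_eq_zero.mp (Subtype.ext h))
  obtain ⟨v, -, hv, -⟩ := exists_homUnit hD (proj_mem δ _) hδ
  have hproj : ∀ j : ℕ,
      GradedRing.proj 𝒜 (δ + (d - j : ℤ) • γ) (r.coeff j : D) ∈ Subring.center D :=
    fun j => proj_mem_of_graded isGradedSubring_center (r.coeff j).2 _
  have hdd : GradedRing.proj 𝒜 (δ + (d - d : ℤ) • γ) (r.coeff d : D) = v := by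
    rw [sub_self, zero_smul, add_zero, hv]
  have hw : ((v⁻¹ : Dˣ) : D) ∈ Subring.center D := by
    have h1 := hproj d
    rw [hdd] at h1
    exact Set.units_inv_mem_center h1
  let a : ℕ → Subring.center D := fun j => ⟨_, hw⟩ * ⟨_, hproj j⟩
  have had : a d = 1 := Subtype.ext (by
    change ((v⁻¹ : Dˣ) : D) * GradedRing.proj 𝒜 (δ + (d - d : ℤ) • γ) (r.coeff d : D) = 1
    rw [hdd, Units.inv_mul])
  have hdeg : (∑ j ∈ Finset.range (d + 1), C (a j) * X ^ j).natDegree ≤ d :=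
    natDegree_sum_le_of_forall_le _ _ fun j hj =>
      (natDegree_C_mul_X_pow_le _ _).trans (Nat.lt_succ_iff.mp (Finset.mem_range.mp hj))
  refine ⟨∑ j ∈ Finset.range (d + 1), C (a j) * X ^ j,
    monic_of_natDegree_le_of_coeff_eq_one d hdeg ?_, ?_, hdeg⟩
  · simp [coeff_C_mul, coeff_X_pow, had]
  · have h1 : GradedRing.proj 𝒜 (δ + d • γ) (eval₂ (Subring.center D).subtype c r) =
        ∑ j ∈ Finset.range (d + 1),
          GradedRing.proj 𝒜 (δ + (d - j : ℤ) • γ) (r.coeff j : D) * c ^ j := by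
      rw [eval₂_eq_sum_range, map_sum]
      refine Finset.sum_congr rfl fun j _ => ?_
      rw [← proj_mul_right (SetLike.pow_mem_graded j hc), add_assoc, sub_smul, natCast_zsmul,
        natCast_zsmul, sub_add_cancel]
      rfl
    rw [hr, map_zero] at h1
    rw [eval₂_finsetSum]
    calc _ = ((v⁻¹ : Dˣ) : D) * ∑ j ∈ Finset.range (d + 1),
          GradedRing.proj 𝒜 (δ + (d - j : ℤ) • γ) (r.coeff j : D) * c ^ j := by
          rw [Finset.mul_sum]
          refine Finset.sum_congr rfl fun j _ => ?_
          rw [C_mul_X_pow_eq_monomial, eval₂_monomial, ← mul_assoc]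
          rfl
      _ = 0 := by rw [← h1, mul_zero]

theorem dvd_of_isMinPolyOf (hD : IsGradedDivisionRing 𝒜) {γ : Γ} {c : D} (hc : c ∈ 𝒜 γ)
    {p q : (Subring.center D)[X]} (hp : IsMinPolyOf (Subring.center D) c p)
    (hq : eval₂ (Subring.center D).subtype c q = 0) : p ∣ q := by
  rw [← modByMonic_eq_zero_iff_dvd hp.1]
  by_contra h0
  have hnt : Nontrivial (Subring.center D) := ⟨0, 1, fun h => hD.1 (congrArg Subtype.val h)⟩
  have hr : eval₂ (Subring.center D).subtype c (q %ₘ p) = 0 := by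
    rw [modByMonic_eq_sub_mul_div, eval₂_sub, mul_comm, eval₂_mul_noncomm, hp.2.1, hq, mul_zero,
      sub_zero]
    exact fun k => (Subring.mem_center_iff.mp (p.coeff k).2 c).symm
  obtain ⟨s, hs, hs0, hsd⟩ := exists_monic_of_eval₂_center_eq_zero hD hc h0 hr
  have h1 := natDegree_le_natDegree (hp.2.2 s hs hs0)
  have h2 := natDegree_lt_natDegree h0 (degree_modByMonic_lt q hp.1)
  omega

end Graded

section Compositum

variable {Γ : Type*} [AddCommGroup Γ] [DecidableEq Γ] {D : Type*} [Ring D]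

/-- A graded division algebra, finite-dimensional over its center, with a maximal subfield `N` of
`D₀` and a maximal graded subfield `T` of `𝖢`. -/
structure CompositumData (𝒜 : Γ → AddSubgroup D) [GradedRing 𝒜] (N T : Subring D) : Prop where
  gradedDivision : IsGradedDivisionRing 𝒜
  finite : finiteOver (Subring.center D)
  maxSubfield : IsMaxSubfieldOf (grade0 𝒜) N
  maxGradedSubfield : IsMaxGradedSubfieldOf 𝒜 (Cc 𝒜 (Subring.center D)) T

/-- The condition that the components of `p` have the form `n * t` and `τ n * (x * t * x⁻¹)`. -/
def IsTwisted (𝒜 : Γ → AddSubgroup D) [GradedRing 𝒜] {N : Subring D} (T : Subring D)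
    (τ : N ≃+* N) (x : Dˣ) (p : D × D) : Prop :=
  ∀ γ, ∃ n : N, ∃ t ∈ T, t ∈ 𝒜 γ ∧ GradedRing.proj 𝒜 γ p.1 = n * t ∧
    GradedRing.proj 𝒜 γ p.2 = τ n * (x * t * ((x⁻¹ : Dˣ) : D))

variable {𝒜 : Γ → AddSubgroup D} [GradedRing 𝒜] {N T : Subring D}

namespace CompositumData

theorem commute (h : CompositumData 𝒜 N T) {n t : D} (hn : n ∈ N) (ht : t ∈ T) : n * t = t * n :=
  mem_Cc_center.mp (h.maxGradedSubfield.2.1 ht) n (h.maxSubfield.1.1 hn)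

theorem centerGrade0_le_left (h : CompositumData 𝒜 N T) : centerGrade0 𝒜 ≤ N := fun _ hz =>
  mem_of_commute_maxSubfield h.gradedDivision h.maxSubfield hz.2 fun y hy =>
    Subring.mem_centralizer_iff.mp hz.1 y (h.maxSubfield.1.1 hy)

theorem centerGrade0_le_right (h : CompositumData 𝒜 N T) : centerGrade0 𝒜 ≤ T := fun z hz =>
  mem_of_commute_maxGradedSubfield h.gradedDivision h.maxGradedSubfield hz.2
    (by rw [Cc_center_eq]; exact hz.1) fun y hy =>
      (mem_Cc_center.mp (h.maxGradedSubfield.2.1 hy) z hz.2).symm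

theorem center_le (h : CompositumData 𝒜 N T) : Subring.center D ≤ T := fun f hf => by
  refine mem_of_proj_mem (𝒜 := 𝒜) fun γ => ?_
  have hc := proj_mem_of_graded (𝒜 := 𝒜) isGradedSubring_center hf γ
  exact mem_of_commute_maxGradedSubfield h.gradedDivision h.maxGradedSubfield (proj_mem _ _)
    (Subring.center_le_centralizer (Uc 𝒜 (Subring.center D) : Set D) hc)
    fun y _ => Subring.mem_center_iff.mp hc y

theorem conj_mem_right (h : CompositumData 𝒜 N T) {u : Dˣ} (hu : u ∈ homUnits 𝒜) {t : D}
    (ht : t ∈ T) : (u : D) * t * ((u⁻¹ : Dˣ) : D) ∈ T := by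
  refine mem_of_proj_mem (𝒜 := 𝒜) fun γ => ?_
  have htγ := proj_mem_of_graded h.maxGradedSubfield.1.1.1 ht γ
  obtain ⟨z, hz, -, hzt⟩ := exists_conj_eq h.gradedDivision hu (proj_mem γ t)
    (h.maxGradedSubfield.2.1 htγ)
  rw [proj_conj hu, hzt]
  exact mul_mem (h.centerGrade0_le_right hz) htγ

theorem eq_zero_or_eq_zero (h : CompositumData 𝒜 N T) (n : N) {t : D} (hnt : (n : D) * t = 0) :
    n = 0 ∨ t = 0 := by
  by_cases h0 : n = 0
  · exact Or.inl h0
  · obtain ⟨y, -, -, hy⟩ := h.maxSubfield.1.2.2 n n.2 fun h => h0 (Subtype.ext h)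
    refine Or.inr ?_
    rw [← one_mul t, ← hy, mul_assoc, hnt, mul_zero]

/-- Homogeneous elements of `T` of the same degree differ by factors in `Z(D₀)`. -/
theorem exists_eq_mul (h : CompositumData 𝒜 N T) {γ : Γ} {t t' : D} (ht : t ∈ T) (htγ : t ∈ 𝒜 γ)
    (h0 : t ≠ 0) (ht' : t' ∈ T) (htγ' : t' ∈ 𝒜 γ) : ∃ z ∈ centerGrade0 𝒜, t' = z * t := by
  obtain ⟨u, -, rfl, hu⟩ := exists_homUnit h.gradedDivision htγ h0
  refine ⟨t' * ((u⁻¹ : Dˣ) : D), ⟨?_, ?_⟩, by simp⟩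
  · rw [← Cc_center_eq]
    exact mul_mem (h.maxGradedSubfield.2.1 ht')
      (units_inv_mem_centralizer (h.maxGradedSubfield.2.1 ht))
  · have := SetLike.mul_mem_graded htγ' hu
    rwa [add_neg_cancel] at this

theorem isTwisted_add (h : CompositumData 𝒜 N T) {τ : N ≃+* N} {x : Dˣ}
    (hx : ∀ z (hz : z ∈ centerGrade0 𝒜), (τ ⟨z, h.centerGrade0_le_left hz⟩ : D) =
      x * z * ((x⁻¹ : Dˣ) : D)) {p q : D × D}
    (hp : IsTwisted 𝒜 T τ x p) (hq : IsTwisted 𝒜 T τ x q) : IsTwisted 𝒜 T τ x (p + q) := by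
  intro γ
  obtain ⟨n, t, ht, htγ, hp1, hp2⟩ := hp γ
  obtain ⟨n', t', ht', htγ', hq1, hq2⟩ := hq γ
  rw [Prod.fst_add, Prod.snd_add, map_add, map_add, hp1, hp2, hq1, hq2]
  by_cases h0 : t = 0
  · exact ⟨n', t', ht', htγ', by simp [h0], by simp [h0]⟩
  · obtain ⟨z, hz, rfl⟩ := h.exists_eq_mul ht htγ h0 ht' htγ'
    refine ⟨n + n' * ⟨z, h.centerGrade0_le_left hz⟩, t, ht, htγ, ?_, ?_⟩
    · simp [add_mul, mul_assoc]
    · rw [map_add, map_mul, Subring.coe_add, Subring.coe_mul, hx z hz]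
      simp [add_mul, mul_assoc]

/-- Homogeneous generators of the graph of the extension of `τ` by conjugation by `x` on `T`. -/
def twistGenerators (h : CompositumData 𝒜 N T) (τ : N ≃+* N) {x : Dˣ} (hx : x ∈ homUnits 𝒜) :
    Submonoid (D × D) where
  carrier := {p | ∃ n : N, ∃ γ, ∃ t ∈ T, t ∈ 𝒜 γ ∧
    p = ((n : D) * t, (τ n : D) * (x * t * ((x⁻¹ : Dˣ) : D)))}
  one_mem' := ⟨1, 0, 1, one_mem T, SetLike.one_mem_graded 𝒜, Prod.ext (by simp) (by simp)⟩
  mul_mem' := by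
    rintro _ _ ⟨n, γ, t, ht, htγ, rfl⟩ ⟨n', γ', t', ht', htγ', rfl⟩
    refine ⟨n * n', γ + γ', t * t', mul_mem ht ht', SetLike.mul_mem_graded htγ htγ', ?_⟩
    have key : ∀ a b c d : D, c * b = b * c → a * b * (c * d) = a * c * (b * d) :=
      fun a b c d hbc => by rw [mul_assoc, ← mul_assoc b, ← hbc, mul_assoc, mul_assoc]
    refine Prod.ext ?_ ?_
    · rw [Prod.fst_mul, key _ _ _ _ (h.commute n'.2 ht), Subring.coe_mul]
    · rw [Prod.snd_mul, key _ _ _ _ (h.commute (τ n').2 (h.conj_mem_right hx ht)), map_mul,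
        Subring.coe_mul]
      congr 1
      simp [mul_assoc]

theorem isTwisted_of_mem (h : CompositumData 𝒜 N T) {τ : N ≃+* N} {x : Dˣ}
    (hxu : x ∈ homUnits 𝒜)
    (hx : ∀ z (hz : z ∈ centerGrade0 𝒜), (τ ⟨z, h.centerGrade0_le_left hz⟩ : D) =
      x * z * ((x⁻¹ : Dˣ) : D)) {p : D × D}
    (hp : p ∈ Subring.closure (h.twistGenerators τ hxu : Set (D × D))) :
    IsTwisted 𝒜 T τ x p := by
  rw [Subring.mem_closure_iff, Submonoid.closure_eq] at hp
  induction hp using AddSubgroup.closure_induction with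
  | mem p hp =>
    obtain ⟨n, γ, t, ht, htγ, rfl⟩ := hp
    have h1 : (n : D) * t ∈ 𝒜 γ := by
      have := SetLike.mul_mem_graded (mem_grade0.mp (h.maxSubfield.1.1 n.2)) htγ
      rwa [zero_add] at this
    have h2 : (τ n : D) * (x * t * ((x⁻¹ : Dˣ) : D)) ∈ 𝒜 γ := by
      have := SetLike.mul_mem_graded (mem_grade0.mp (h.maxSubfield.1.1 (τ n).2))
        (conj_mem hxu htγ)
      rwa [zero_add] at this
    intro δ
    by_cases hδ : γ = δ
    · subst hδ
      exact ⟨n, t, ht, htγ, proj_of_mem h1, proj_of_mem h2⟩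
    · exact ⟨0, 0, zero_mem _, zero_mem _, by simpa using proj_of_mem_ne h1 hδ,
        by simpa using proj_of_mem_ne h2 hδ⟩
  | zero => exact fun γ => ⟨0, 0, zero_mem _, zero_mem _, by simp, by simp⟩
  | add p q _ _ hp hq => exact h.isTwisted_add hx hp hq
  | neg p _ hp =>
    intro γ
    obtain ⟨n, t, ht, htγ, hp1, hp2⟩ := hp γ
    exact ⟨-n, t, ht, htγ, by rw [Prod.fst_neg, map_neg, hp1]; simp,
      by rw [Prod.snd_neg, map_neg, hp2]; simp⟩

theorem twist_ext (h : CompositumData 𝒜 N T) {τ : N ≃+* N} {x : Dˣ} {p : D × D}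
    (hp : IsTwisted 𝒜 T τ x p) : p.1 = 0 ↔ p.2 = 0 := by
  have hinj : ∀ t : D, (x : D) * t * ((x⁻¹ : Dˣ) : D) = 0 → t = 0 := fun t ht => by
    rw [← inv_conj_conj x t, ht, mul_zero, zero_mul]
  constructor
  · intro h0
    refine ext_proj (𝒜 := 𝒜) fun γ => ?_
    obtain ⟨n, t, -, -, hp1, hp2⟩ := hp γ
    rw [h0, map_zero] at hp1
    rw [hp2, map_zero]
    obtain rfl | rfl := h.eq_zero_or_eq_zero n hp1.symm <;> simp
  · intro h0
    refine ext_proj (𝒜 := 𝒜) fun γ => ?_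
    obtain ⟨n, t, -, -, hp1, hp2⟩ := hp γ
    rw [h0, map_zero] at hp2
    rw [hp1, map_zero]
    rcases h.eq_zero_or_eq_zero (τ n) hp2.symm with h1 | h1
    · rw [(map_eq_zero_iff τ τ.injective).mp h1]
      simp
    · simp [hinj t h1]

theorem map_fst_closure (h : CompositumData 𝒜 N T) (τ : N ≃+* N) {x : Dˣ}
    (hx : x ∈ homUnits 𝒜) :
    (Subring.closure (h.twistGenerators τ hx : Set (D × D))).map (RingHom.fst D D) =
      N ⊔ Subring.center D ⊔ T := by
  apply le_antisymm
  · rw [RingHom.map_closure, Subring.closure_le]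
    rintro _ ⟨_, ⟨n, γ, t, ht, -, rfl⟩, rfl⟩
    exact mul_mem (le_sup_left (b := T) (le_sup_left (b := Subring.center D) n.2))
      (le_sup_right (b := T) ht)
  · have hT : T ≤ (Subring.closure (h.twistGenerators τ hx : Set (D × D))).map
        (RingHom.fst D D) := fun t ht => by
      refine mem_of_proj_mem (𝒜 := 𝒜) fun γ => ⟨_, Subring.subset_closure ⟨1, γ, _,
        proj_mem_of_graded h.maxGradedSubfield.1.1.1 ht γ, proj_mem γ t, rfl⟩, by simp⟩
    refine sup_le (sup_le (fun n hn => ?_) (h.center_le.trans hT)) hT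
    exact ⟨_, Subring.subset_closure ⟨⟨n, hn⟩, 0, 1, one_mem T, SetLike.one_mem_graded 𝒜, rfl⟩,
      by simp⟩

theorem map_snd_closure (h : CompositumData 𝒜 N T) (τ : N ≃+* N) {x : Dˣ}
    (hx : x ∈ homUnits 𝒜) :
    (Subring.closure (h.twistGenerators τ hx : Set (D × D))).map (RingHom.snd D D) =
      N ⊔ Subring.center D ⊔ T := by
  apply le_antisymm
  · rw [RingHom.map_closure, Subring.closure_le]
    rintro _ ⟨_, ⟨n, γ, t, ht, -, rfl⟩, rfl⟩
    exact mul_mem (le_sup_left (b := T) (le_sup_left (b := Subring.center D) (τ n).2))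
      (le_sup_right (b := T) (h.conj_mem_right hx ht))
  · have hT : T ≤ (Subring.closure (h.twistGenerators τ hx : Set (D × D))).map
        (RingHom.snd D D) := fun t ht => by
      refine mem_of_proj_mem (𝒜 := 𝒜) fun γ => ⟨_, Subring.subset_closure ⟨1, γ, _,
        h.conj_mem_right (inv_mem hx) (proj_mem_of_graded h.maxGradedSubfield.1.1.1 ht γ),
        conj_mem (inv_mem hx) (proj_mem γ t), rfl⟩, ?_⟩
      simp [mul_assoc]
    refine sup_le (sup_le (fun n hn => ?_) (h.center_le.trans hT)) hT
    exact ⟨_, Subring.subset_closure ⟨τ.symm ⟨n, hn⟩, 0, 1, one_mem T, SetLike.one_mem_graded 𝒜,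
      rfl⟩, by simp⟩

/-- The compositum consists of the elements with components in `N * T`. -/
theorem exists_proj_eq_mul (h : CompositumData 𝒜 N T) {m : D}
    (hm : m ∈ N ⊔ Subring.center D ⊔ T) (γ : Γ) :
    ∃ n ∈ N, ∃ t ∈ T, t ∈ 𝒜 γ ∧ GradedRing.proj 𝒜 γ m = n * t := by
  rw [← h.map_fst_closure (RingEquiv.refl N) (one_mem _)] at hm
  obtain ⟨p, hp, rfl⟩ := hm
  obtain ⟨n, t, ht, htγ, h1, -⟩ := h.isTwisted_of_mem (one_mem _) (fun z hz => by simp) hp γ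
  exact ⟨n, n.2, t, ht, htγ, h1⟩

/-- An automorphism of `N` which is conjugation by `x` on `Z(D₀)` extends to the compositum, acting
on `T` as conjugation by `x`. -/
theorem exists_extension (h : CompositumData 𝒜 N T) {τ : N ≃+* N} {x : Dˣ}
    (hxu : x ∈ homUnits 𝒜)
    (hx : ∀ z (hz : z ∈ centerGrade0 𝒜), (τ ⟨z, h.centerGrade0_le_left hz⟩ : D) =
      x * z * ((x⁻¹ : Dˣ) : D)) :
    ∃ σ : ↥(N ⊔ Subring.center D ⊔ T) ≃+* ↥(N ⊔ Subring.center D ⊔ T),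
      (∀ y : ↥(N ⊔ Subring.center D ⊔ T), (y : D) ∈ Subring.center D → σ y = y) ∧
      ∀ (n : N) (γ : Γ) (t : D), t ∈ T → t ∈ 𝒜 γ →
        ∀ m : ↥(N ⊔ Subring.center D ⊔ T), ((m : D) = n * t →
          (σ m : D) = τ n * (x * t * ((x⁻¹ : Dˣ) : D))) ∧
        (GradedRing.proj 𝒜 γ (m : D) = n * t →
          GradedRing.proj 𝒜 γ (σ m : D) = τ n * (x * t * ((x⁻¹ : Dˣ) : D))) := by
  set G := Subring.closure (h.twistGenerators τ hxu : Set (D × D)) with hG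
  have htw : ∀ p : G, IsTwisted 𝒜 T τ x p := fun p => h.isTwisted_of_mem hxu hx p.2
  let e₁ : G ≃+* ↥(N ⊔ Subring.center D ⊔ T) := RingEquiv.ofBijective
    (((RingHom.fst D D).comp G.subtype).codRestrict _ fun p => by
      rw [← h.map_fst_closure τ hxu]
      exact ⟨p, p.2, rfl⟩)
    ⟨(injective_iff_map_eq_zero _).mpr fun p hp => by
      have h1 : (p : D × D).1 = 0 := congrArg Subtype.val hp
      exact Subtype.ext (Prod.ext h1 ((h.twist_ext (htw p)).mp h1)), fun m => by
      obtain ⟨p, hp, hpm⟩ := (h.map_fst_closure τ hxu).ge m.2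
      exact ⟨⟨p, hp⟩, Subtype.ext hpm⟩⟩
  let e₂ : G ≃+* ↥(N ⊔ Subring.center D ⊔ T) := RingEquiv.ofBijective
    (((RingHom.snd D D).comp G.subtype).codRestrict _ fun p => by
      rw [← h.map_snd_closure τ hxu]
      exact ⟨p, p.2, rfl⟩)
    ⟨(injective_iff_map_eq_zero _).mpr fun p hp => by
      have h1 : (p : D × D).2 = 0 := congrArg Subtype.val hp
      exact Subtype.ext (Prod.ext ((h.twist_ext (htw p)).mpr h1) h1), fun m => by
      obtain ⟨p, hp, hpm⟩ := (h.map_snd_closure τ hxu).ge m.2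
      exact ⟨⟨p, hp⟩, Subtype.ext hpm⟩⟩
  have key : ∀ p : G, ∀ m : ↥(N ⊔ Subring.center D ⊔ T), (m : D) = (p : D × D).1 →
      (e₂ (e₁.symm m) : D) = (p : D × D).2 := fun p m hm => by
    have h1 : e₁ p = m := Subtype.ext hm.symm
    rw [← h1, RingEquiv.symm_apply_apply]
    rfl
  refine ⟨e₁.symm.trans e₂, fun y hy => ?_, fun n γ t ht htγ m => ⟨fun hm => ?_, fun hm => ?_⟩⟩
  · have hyG : (y : D) ∈ G.comap ((RingHom.id D).prod (RingHom.id D)) := by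
      refine mem_of_proj_mem (𝒜 := 𝒜) fun γ => Subring.subset_closure ⟨1, γ, _,
        proj_mem_of_graded h.maxGradedSubfield.1.1.1 (h.center_le hy) γ, proj_mem γ _, ?_⟩
      have hc := Subring.mem_center_iff.mp
        (proj_mem_of_graded (𝒜 := 𝒜) isGradedSubring_center hy γ) x
      exact Prod.ext (by simp) (by rw [hc, Units.mul_inv_cancel_right]; simp)
    exact Subtype.ext (key ⟨_, hyG⟩ y rfl)
  · exact key ⟨_, Subring.subset_closure ⟨n, γ, t, ht, htγ, rfl⟩⟩ m hm
  · obtain ⟨n', t', ht', htγ', h1, h2⟩ := htw (e₁.symm m) γ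
    have h3 : ((e₁.symm m : G) : D × D).1 = m := congrArg Subtype.val (e₁.apply_symm_apply m)
    have hmem : (n : D) * t ∈ N ⊔ Subring.center D ⊔ T :=
      mul_mem (le_sup_left (b := T) (le_sup_left (b := Subring.center D) n.2))
        (le_sup_right (b := T) ht)
    have h4 := key ⟨_, Subring.subset_closure ⟨n, γ, t, ht, htγ, rfl⟩⟩ ⟨_, hmem⟩ rfl
    have h5 := key ⟨_, Subring.subset_closure ⟨n', γ, t', ht', htγ', rfl⟩⟩ ⟨_, hmem⟩
      (hm.symm.trans ((congrArg (GradedRing.proj 𝒜 γ) h3).symm.trans h1))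
    exact h2.trans (h5.symm.trans h4)

theorem isField_left (h : CompositumData 𝒜 N T) : IsField N :=
  isField_of_inv h.gradedDivision.1 h.maxSubfield.1.2.1 fun x hx h0 => by
    obtain ⟨y, hy, hxy, -⟩ := h.maxSubfield.1.2.2 x hx h0
    exact ⟨y, hy, hxy⟩

theorem left_le (_ : CompositumData 𝒜 N T) : N ≤ N ⊔ Subring.center D ⊔ T :=
  le_sup_left.trans le_sup_left

theorem compositum_comm (h : CompositumData 𝒜 N T) :
    ∀ x ∈ N ⊔ Subring.center D ⊔ T, ∀ y ∈ N ⊔ Subring.center D ⊔ T, x * y = y * x := by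
  have hN : N ⊔ Subring.center D ⊔ T ≤ Subring.centralizer (N : Set D) :=
    sup_le (sup_le (fun x hx => Subring.mem_centralizer_iff.mpr fun y hy =>
      h.maxSubfield.1.2.1 y hy x hx) (Subring.center_le_centralizer _))
      (fun x hx => Subring.mem_centralizer_iff.mpr fun y hy => h.commute hy hx)
  have hT : N ⊔ Subring.center D ⊔ T ≤ Subring.centralizer (T : Set D) :=
    sup_le (sup_le (fun x hx => Subring.mem_centralizer_iff.mpr fun y hy =>
      (h.commute hx hy).symm) (Subring.center_le_centralizer _))
      (fun x hx => Subring.mem_centralizer_iff.mpr fun y hy =>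
        h.maxGradedSubfield.1.2 y hy x hx)
  have hM : N ⊔ Subring.center D ⊔ T ≤
      Subring.centralizer (N ⊔ Subring.center D ⊔ T : Subring D) :=
    sup_le (sup_le (fun x hx => Subring.mem_centralizer_iff.mpr fun y hy =>
      (Subring.mem_centralizer_iff.mp (hN hy) x hx).symm) (Subring.center_le_centralizer _))
      (fun x hx => Subring.mem_centralizer_iff.mpr fun y hy =>
        (Subring.mem_centralizer_iff.mp (hT hy) x hx).symm)
  exact fun x hx y hy => Subring.mem_centralizer_iff.mp (hM hy) x hx

theorem isGradedSubring_compositum (h : CompositumData 𝒜 N T) :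
    IsGradedSubring 𝒜 (N ⊔ Subring.center D ⊔ T) := fun m hm γ => by
  obtain ⟨n, hn, t, ht, -, heq⟩ := h.exists_proj_eq_mul hm γ
  change GradedRing.proj 𝒜 γ m ∈ _
  rw [heq]
  exact mul_mem (h.left_le hn) (le_sup_right (b := T) ht)

theorem mem_of_commute (h : CompositumData 𝒜 N T) {γ : Γ} {y : D} (hy : y ∈ 𝒜 γ)
    (hc : ∀ m ∈ N ⊔ Subring.center D ⊔ T, m * y = y * m) : y ∈ N ⊔ Subring.center D ⊔ T := by
  by_cases h0 : y = 0
  · rw [h0]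
    exact zero_mem _
  obtain ⟨u, hu, rfl, -⟩ := exists_homUnit h.gradedDivision hy h0
  obtain ⟨d, -, hd0, c, hcu, hcC, rfl⟩ := exists_mul_of_commute_centerGrade0 h.gradedDivision
    h.finite hu fun z hz => (hc z (h.left_le (h.centerGrade0_le_left hz))).symm
  rw [Units.val_mul] at hc ⊢
  have hdN : (d : D) ∈ N := mem_of_commute_maxSubfield h.gradedDivision h.maxSubfield hd0
    fun n hn => by
      have h1 := hc n (h.left_le hn)
      rw [mul_assoc (d : D), ← mem_Cc_center.mp hcC n (h.maxSubfield.1.1 hn), ← mul_assoc,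
        ← mul_assoc, Units.mul_left_inj] at h1
      exact h1
  have hcT : (c : D) ∈ T := by
    obtain ⟨δ, hcδ, -⟩ := hcu
    refine mem_of_commute_maxGradedSubfield h.gradedDivision h.maxGradedSubfield hcδ hcC
      fun t ht => ?_
    have h1 := hc t (le_sup_right (b := T) ht)
    rw [← mul_assoc, ← h.commute hdN ht, mul_assoc, mul_assoc, Units.mul_right_inj] at h1
    exact h1
  exact mul_mem (h.left_le hdN) (le_sup_right (b := T) hcT)

theorem isMaxGradedSubfield_compositum (h : CompositumData 𝒜 N T) :
    IsMaxGradedSubfieldOf 𝒜 ⊤ (N ⊔ Subring.center D ⊔ T) := by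
  refine ⟨⟨⟨h.isGradedSubring_compositum, fun γ x hx hγ h0 => ?_⟩, h.compositum_comm⟩, le_top,
    fun T' hT' _ hle => le_antisymm (fun x hx => ?_) hle⟩
  · obtain ⟨y, hy, hyγ, hxy, hyx⟩ := inv_mem_of_mem_centralizer h.gradedDivision
      (S := (N ⊔ Subring.center D ⊔ T : Subring D))
      (Subring.mem_centralizer_iff.mpr fun z hz => h.compositum_comm z hz x hx) hγ h0
    exact ⟨y, h.mem_of_commute hyγ (Subring.mem_centralizer_iff.mp hy), hxy, hyx⟩
  · exact mem_of_proj_mem (𝒜 := 𝒜) fun γ => h.mem_of_commute (proj_mem γ x) fun m hm =>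
      hT'.2 m (hle hm) _ (proj_mem_of_graded hT'.1.1 hx γ)

theorem exists_conj_of_fixed (h : CompositumData 𝒜 N T) (τ : N ≃+* N)
    (hτ : ∀ y : N, (y : D) ∈ Subring.center D ⊓ grade0 𝒜 → τ y = y) :
    ∃ x ∈ homUnits 𝒜, ∀ z (hz : z ∈ centerGrade0 𝒜),
      (τ ⟨z, h.centerGrade0_le_left hz⟩ : D) = x * z * ((x⁻¹ : Dˣ) : D) := by
  have hD := h.gradedDivision
  obtain ⟨g, ⟨u, hu, hgu⟩, hg⟩ := (exists_aut_of_fixed (isField_center_inf_grade0 hD)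
    (isField_centerGrade0 hD) (Subring.inclusion center_inf_grade0_le)
    (exists_finset_sum hD h.finite center_inf_grade0_le inf_le_right) (conjAuts 𝒜)
    (fun g hg k => conjAuts_fixes hg k) (conjAuts_fixed hD)).1 h.isField_left
    (Subring.inclusion h.centerGrade0_le_left) (τ : N →+* N) fun k => hτ _ k.2
  exact ⟨u, hu, fun z hz => (congrArg Subtype.val (hg ⟨z, hz⟩)).trans (hgu ⟨z, hz⟩)⟩

theorem conj_refl (h : CompositumData 𝒜 N T) {c : Dˣ} (hc : (c : D) ∈ Cc 𝒜 (Subring.center D))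
    (z : D) (hz : z ∈ centerGrade0 𝒜) :
    (RingEquiv.refl N ⟨z, h.centerGrade0_le_left hz⟩ : D) = c * z * ((c⁻¹ : Dˣ) : D) := by
  rw [← mem_Cc_center.mp hc z hz.2, Units.mul_inv_cancel_right]
  rfl

theorem center_le_compositum (h : CompositumData 𝒜 N T) :
    Subring.center D ≤ N ⊔ Subring.center D ⊔ T :=
  h.center_le.trans le_sup_right

theorem isGaloisExt_compositum (h : CompositumData 𝒜 N T)
    (hN : IsGaloisExt (Subring.center D ⊓ grade0 𝒜) N) :
    IsGaloisExt (Subring.center D) (N ⊔ Subring.center D ⊔ T) := by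
  refine ⟨h.center_le_compositum, fun x hx => mem_of_proj_mem (𝒜 := 𝒜) fun γ => ?_⟩
  obtain ⟨n, hn, t, ht, htγ, hnt⟩ := h.exists_proj_eq_mul x.2 γ
  by_cases h0 : GradedRing.proj 𝒜 γ (x : D) = 0
  · rw [h0]
    exact zero_mem _
  have hn0 : n ≠ 0 := fun h1 => h0 (by rw [hnt, h1, zero_mul])
  have ht0 : t ≠ 0 := fun h1 => h0 (by rw [hnt, h1, mul_zero])
  have hcancel : ∀ a b : D, n * a = n * b → a = b := fun a b hab => by
    obtain ⟨y, -, -, hy⟩ := h.maxSubfield.1.2.2 n hn hn0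
    rw [← one_mul a, ← hy, mul_assoc, hab, ← mul_assoc, hy, one_mul]
  obtain ⟨z, hz, hz0, hzt⟩ := exists_mul_mem_center h.gradedDivision h.finite htγ ht0
    (h.maxGradedSubfield.2.1 ht) fun c hc hcC => by
      obtain ⟨σ, hσF, hσ⟩ := h.exists_extension hc (h.conj_refl hcC)
      have h1 := (hσ ⟨n, hn⟩ γ t ht htγ x).2 hnt
      rw [hx σ hσF, hnt] at h1
      have h2 := hcancel _ _ h1
      exact ((Units.eq_mul_inv_iff_mul_eq _).mp h2).symm
  obtain ⟨z', hz'⟩ := (isField_centerGrade0 h.gradedDivision).mul_inv_cancel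
    (a := (⟨z, hz⟩ : ↥(centerGrade0 𝒜))) fun h1 => hz0 (congrArg Subtype.val h1)
  have hzz : (z' : D) * z = 1 := by
    rw [(isField_centerGrade0 h.gradedDivision).mul_comm] at hz'
    exact congrArg Subtype.val hz'
  have hf0 : z * t ≠ 0 := fun h1 => ht0 (by
    rw [← one_mul t, ← hzz, mul_assoc, h1, mul_zero])
  have hfγ : z * t ∈ 𝒜 γ := by
    have h1 := SetLike.mul_mem_graded (mem_grade0.mp hz.2) htγ
    rwa [zero_add] at h1
  obtain ⟨f, -, hf, -⟩ := exists_homUnit h.gradedDivision hfγ hf0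
  have hn'N : n * z' ∈ N := mul_mem hn (h.centerGrade0_le_left z'.2)
  have hnf : GradedRing.proj 𝒜 γ (x : D) = n * z' * (z * t) := by
    rw [hnt, mul_assoc, ← mul_assoc (z' : D), hzz, one_mul]
  have hn' : n * z' ∈ Subring.center D ⊓ grade0 𝒜 := hN.2 ⟨n * z', hn'N⟩ fun τ hτ => by
    obtain ⟨u, hu, hτu⟩ := h.exists_conj_of_fixed τ hτ
    obtain ⟨σ, hσF, hσ⟩ := h.exists_extension hu hτu
    have h1 := (hσ ⟨n * z', hn'N⟩ γ (z * t) (h.center_le hzt) hfγ x).2 hnf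
    rw [hx σ hσF, hnf, Subring.mem_center_iff.mp hzt u, Units.mul_inv_cancel_right, ← hf,
      Units.mul_left_inj] at h1
    exact Subtype.ext h1.symm
  rw [hnf]
  exact mul_mem hn'.1 hzt

open Polynomial

theorem exists_pow_commute (h : CompositumData 𝒜 N T) [NoZeroDivisors D] {n t : D} (hn : n ∈ N)
    (ht : t ∈ T) {γ : Γ} (htγ : t ∈ 𝒜 γ) (h0 : n * t ≠ 0) {p : (Subring.center D)[X]}
    (hp : p.Monic) (hpc : eval₂ (Subring.center D).subtype (n * t) p = 0) :
    ∃ (e : ℕ) (ζ : centerGrade0 𝒜), 0 < e ∧ ζ ^ e = 1 ∧ (∀ l, ζ ^ l = 1 → e ∣ l) ∧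
      ∀ x ∈ homUnits 𝒜, (x : D) ∈ Cc 𝒜 (Subring.center D) → (x : D) * t ^ e = t ^ e * x := by
  have hnt : Nontrivial D := ⟨0, 1, h.gradedDivision.1⟩
  have ht0 : t ≠ 0 := right_ne_zero_of_mul h0
  have hM := h.left_le
  have hZM : centerGrade0 𝒜 ≤ N ⊔ Subring.center D ⊔ T := h.centerGrade0_le_left.trans hM
  have hcM : n * t ∈ N ⊔ Subring.center D ⊔ T := mul_mem (hM hn) (le_sup_right (b := T) ht)
  have hZC : ∀ z : centerGrade0 𝒜, ∀ x : Dˣ, (x : D) ∈ Cc 𝒜 (Subring.center D) →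
      (z : D) * x = x * z := fun z x hx => mem_Cc_center.mp hx z z.2.2
  let μ : Set (centerGrade0 𝒜) := {z | ∃ x ∈ homUnits 𝒜, (x : D) ∈ Cc 𝒜 (Subring.center D) ∧
    (x : D) * t = z * t * x}
  have hfin : μ.Finite := by
    refine Set.Finite.subset ((finite_setOf_eval₂_eq_zero
      (fun x y => Subtype.ext (Subring.mem_center_iff.mp y.2 x))
      (fun x y => Subtype.ext (h.compositum_comm x x.2 y y.2))
      (Subring.inclusion h.center_le_compositum) hp).preimage
      (f := fun z : centerGrade0 𝒜 => Subring.inclusion hZM z * ⟨n * t, hcM⟩) ?_) ?_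
    · intro z _ z' _ hzz
      exact Subtype.ext (mul_right_cancel₀ h0 (congrArg Subtype.val hzz))
    · rintro z ⟨x, hx, hxC, hxt⟩
      refine Subtype.ext ((coe_eval₂_inclusion _ _ _).trans ?_)
      have h1 : (z : D) * (n * t) = x * (n * t) * ((x⁻¹ : Dˣ) : D) := by
        rw [Units.eq_mul_inv_iff_mul_eq, ← mul_assoc (z : D), ← mul_assoc (x : D),
          h.maxSubfield.1.2.1 z (h.centerGrade0_le_left z.2) n hn,
          ← mem_Cc_center.mp hxC n (h.maxSubfield.1.1 hn), mul_assoc n (x : D), hxt]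
        simp only [mul_assoc]
      change eval₂ (Subring.center D).subtype ((z : D) * (n * t)) p = 0
      rw [h1, eval₂_center_conj, hpc, mul_zero, zero_mul]
  obtain ⟨e, ζ, he, hζ, hζe, hμ⟩ := exists_primitive_of_finite
    (isField_centerGrade0 h.gradedDivision) μ hfin
    ⟨1, one_mem _, by rw [Units.val_one]; exact one_mem _, by simp⟩
    (by
      rintro z ⟨x, hx, hxC, hxt⟩ z' ⟨y, hy, hyC, hyt⟩
      refine ⟨x * y, mul_mem hx hy, by rw [Units.val_mul]; exact mul_mem hxC hyC, ?_⟩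
      rw [Units.val_mul, (isField_centerGrade0 h.gradedDivision).mul_comm, Subring.coe_mul,
        mul_assoc, hyt, ← mul_assoc, ← mul_assoc, ← hZC z' x hxC, mul_assoc (z' : D), hxt]
      simp only [mul_assoc])
    (by
      rintro z ⟨x, hx, hxC, hxt⟩
      have hz0 : z ≠ 0 := by
        rintro rfl
        rw [Subring.coe_zero, zero_mul, zero_mul] at hxt
        exact ht0 ((Units.mul_right_eq_zero x).mp hxt)
      obtain ⟨y, hy⟩ := (isField_centerGrade0 h.gradedDivision).mul_inv_cancel hz0
      refine ⟨y, ⟨x⁻¹, inv_mem hx, units_inv_mem_centralizer hxC, ?_⟩, hy⟩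
      have hy' : (y : D) * z = 1 := by
        rw [(isField_centerGrade0 h.gradedDivision).mul_comm] at hy
        exact congrArg Subtype.val hy
      rw [Units.eq_mul_inv_iff_mul_eq, mul_assoc, Units.inv_mul_eq_iff_eq_mul, ← mul_assoc,
        ← hZC y x hxC, mul_assoc, hxt, ← mul_assoc, ← mul_assoc, hy', one_mul])
  refine ⟨e, ζ, he, hζ, hζe, fun x hx hxC => ?_⟩
  obtain ⟨z, hz, -, hzt⟩ := exists_conj_eq h.gradedDivision hx htγ (h.maxGradedSubfield.2.1 ht)
  have hzt' := (Units.mul_inv_eq_iff_eq_mul _).mp hzt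
  have hze : z ^ e = 1 := congrArg Subtype.val (hμ ⟨z, hz⟩ ⟨x, hx, hxC, hzt'⟩)
  have hzc : Commute z t := h.commute (h.centerGrade0_le_left hz) ht
  have hsc : SemiconjBy (x : D) t (z * t) := hzt'
  have := (hsc.pow_right e).eq
  rwa [hzc.mul_pow, hze, one_mul] at this

theorem isNormalExtGr_compositum (h : CompositumData 𝒜 N T) (hΓ : TorsionFree Γ)
    (hN : IsNormalExt (Subring.center D ⊓ grade0 𝒜) N) :
    IsNormalExtGr 𝒜 (Subring.center D) (N ⊔ Subring.center D ⊔ T) := by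
  have := noZeroDivisors hΓ h.gradedDivision
  have hnt : Nontrivial D := ⟨0, 1, h.gradedDivision.1⟩
  refine ⟨h.center_le_compositum, fun c hc ⟨γ, hcγ⟩ p hp => ?_⟩
  have hcomm : ∀ x y : ↥(N ⊔ Subring.center D ⊔ T), x * y = y * x := fun x y =>
    Subtype.ext (h.compositum_comm x x.2 y y.2)
  have hFcomm : ∀ x y : Subring.center D, x * y = y * x := fun x y =>
    Subtype.ext (Subring.mem_center_iff.mp y.2 x)
  have hdvd : ∀ q, eval₂ (Subring.inclusion h.center_le_compositum) ⟨c, hc⟩ q = 0 → p ∣ q :=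
    fun q hq => dvd_of_isMinPolyOf h.gradedDivision hcγ hp
      ((coe_eval₂_inclusion _ _ q).symm.trans (congrArg Subtype.val hq))
  by_cases h0 : c = 0
  · subst h0
    exact exists_list_of_splitting_pow hFcomm hFcomm hcomm (RingHom.id _) _ monic_X 1 one_pos
      (ζ := 1) (one_pow 1) (fun l _ => one_dvd l) [()] 0 0 (by simp) (by simp) 0 ⟨0, hc⟩
      (by rw [mul_zero, pow_one]; rfl) (by simp) p hp.1 hdvd
  obtain ⟨n, hn, t, ht, htγ, hct⟩ := h.exists_proj_eq_mul hc γ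
  rw [proj_of_mem hcγ] at hct
  subst hct
  have ht0 : t ≠ 0 := right_ne_zero_of_mul h0
  obtain ⟨e, ζ, he, hζ, hζe, hte⟩ := h.exists_pow_commute hn ht htγ h0 hp.1 hp.2.1
  obtain ⟨z, hz, hz0, hzt⟩ := exists_mul_mem_center h.gradedDivision h.finite
    (SetLike.pow_mem_graded e htγ) (pow_ne_zero e ht0) (pow_mem (h.maxGradedSubfield.2.1 ht) e) hte
  obtain ⟨z', hz'⟩ := (isField_centerGrade0 h.gradedDivision).mul_inv_cancel
    (a := (⟨z, hz⟩ : ↥(centerGrade0 𝒜))) fun h1 => hz0 (congrArg Subtype.val h1)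
  have hzz : (z' : D) * z = 1 := by
    rw [(isField_centerGrade0 h.gradedDivision).mul_comm] at hz'
    exact congrArg Subtype.val hz'
  obtain ⟨hle, hsplit⟩ := hN
  let u : N := ⟨n, hn⟩ ^ e * ⟨z', h.centerGrade0_le_left z'.2⟩
  obtain ⟨P, l, hP, hl, hPu, hPl⟩ := exists_split_over_aut
    (isField_center_inf_grade0 h.gradedDivision) h.isField_left (Subring.inclusion hle)
    (exists_finset_sum h.gradedDivision h.finite hle h.maxSubfield.1.1)
    (fun c p hp hpc hmin => hsplit c c.2 p ⟨hp,
      (coe_eval₂_inclusion hle c p).symm.trans (congrArg Subtype.val hpc),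
      fun q hq hqc => hmin q hq (Subtype.ext ((coe_eval₂_inclusion hle c q).trans hqc))⟩) u
  set β := Subring.inclusion h.center_le_compositum
  set ι := Subring.inclusion h.left_le
  let f : Subring.center D := ⟨z * t ^ e, hzt⟩
  have hce : (⟨n * t, hc⟩ : ↥(N ⊔ Subring.center D ⊔ T)) ^ e = β f * ι u := Subtype.ext (by
    change (n * t) ^ e = z * t ^ e * (n ^ e * z')
    rw [← Subring.mem_center_iff.mp hzt, Commute.mul_pow (h.commute hn ht), mul_assoc,
      ← mul_assoc (z' : D), hzz, one_mul])
  have hv : ∀ τ : N ≃+* N, (∀ k, τ (Subring.inclusion hle k) = Subring.inclusion hle k) →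
      ∃ m, m ^ e = β f * ι (τ u) := fun τ hτ => by
    obtain ⟨x, hx, hτx⟩ := h.exists_conj_of_fixed τ fun y hy => hτ ⟨y, hy⟩
    obtain ⟨σ, hσF, hσ⟩ := h.exists_extension hx hτx
    refine ⟨σ ⟨n * t, hc⟩, ?_⟩
    rw [← map_pow, hce, map_mul, hσF _ f.2]
    congr 1
    refine Subtype.ext (((hσ u 0 1 (one_mem _) (SetLike.one_mem_graded 𝒜) (ι u)).1
      (mul_one _).symm).trans ?_)
    simp [ι]
  choose! v hv using hv
  exact exists_list_of_splitting_pow (isField_center_inf_grade0 h.gradedDivision).mul_comm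
    hFcomm hcomm (Subring.inclusion inf_le_left) β hP f he
    (ζ := Subring.inclusion (h.centerGrade0_le_left.trans h.left_le) ζ)
    (by rw [← map_pow, hζ, map_one])
    (fun l hl => hζe l (Subring.inclusion_injective _
      ((map_pow _ ζ l).trans (hl.trans (map_one _).symm))))
    l (fun τ => ι (τ u)) v
    (by
      change P.map (ι.comp (Subring.inclusion hle)) = _
      rw [← Polynomial.map_map, hPl, Polynomial.map_list_prod, List.map_map]
      congr 1
      exact List.map_congr_left fun τ _ => by simp)
    (fun τ hτ => hv τ (hl τ hτ)) (ι u) ⟨n * t, hc⟩ hce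
    (by
      change eval₂ (ι.comp (Subring.inclusion hle)) (ι u) P = 0
      rw [← hom_eval₂, hPu, map_zero]) p hp.1 hdvd

end CompositumData

end Compositum

end GradedDivPaper

namespace GradedDivPaper

/-- if `N` is a maximal subfield of `D₀`, `𝖫` the graded subfield
generated by `N` over `F`, and `T` a maximal graded subfield of `𝖢`, then `𝖫⬝T` is a
maximal graded subfield of `D`, which is Galois (resp. normal) over `F` whenever
`N/F₀` is. -/
theorem stmt_10 {Γ : Type*} [AddCommGroup Γ] [DecidableEq Γ] {D : Type*} [Ring D]
    (hΓ : TorsionFree Γ) (𝒜 : Γ → AddSubgroup D) [GradedRing 𝒜]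
    (hD : IsGradedDivisionRing 𝒜)
    (F : Subring D) (hFcen : F = Subring.center D) (hfin : finiteOver F)
    (N : Subring D) (hN0 : N ≤ grade0 𝒜) (hN : IsMaxSubfieldOf (grade0 𝒜) N)
    (T : Subring D) (hT : IsMaxGradedSubfieldOf 𝒜 (Cc 𝒜 F) T) :
    IsMaxGradedSubfieldOf 𝒜 ⊤ ((N ⊔ F) ⊔ T) ∧
    (IsGaloisExt (F ⊓ grade0 𝒜) N → IsGaloisExt F ((N ⊔ F) ⊔ T)) ∧
    (IsNormalExt (F ⊓ grade0 𝒜) N → IsNormalExtGr 𝒜 F ((N ⊔ F) ⊔ T)) := by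
  subst hFcen
  have h : CompositumData 𝒜 N T := ⟨hD, hfin, hN, hT⟩
  exact ⟨h.isMaxGradedSubfield_compositum, h.isGaloisExt_compositum,
    h.isNormalExtGr_compositum hΓ⟩

end GradedDivPaper
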